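/- Assume g is increasing and κ is finite on ℝ. For c ∈ ℝ let v(x,c) = inf_τ E[∫_0^τ g(x + X_t) e^{−rt} dt + c e^{−rτ}], the infimum being over all stopping times τ of the natural filtration of X (with values in [0,∞] and the convention e^{−rτ} = 0 on {τ = ∞}). Then the first passage time τ*(c) = inf{t ≥ 0 : κ(x + X_t) ≥ c} attains the infimum, i.e. v(x,c) = E[∫_0^{τ*(c)} g(x + X_t) e^{−rt} dt + c e^{−r τ*(c)}]; moreover v(x,c) = c if κ(x) ≥ c and v(x,c) < c if κ(x) < c. -/

import Mathlib

open MeasureTheory Set Filter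
open scoped ENNReal NNReal

noncomputable section

/-- The running supremum `X̄_t = sup_{0 ≤ s ≤ t} X_s` of a process. -/
def runSup {Ω : Type*} (X : ℝ → Ω → ℝ) (t : ℝ) (ω : Ω) : ℝ :=
  sSup ((fun s => X s ω) '' Set.Icc 0 t)

/-- The running infimum `X̲_t = inf_{0 ≤ s ≤ t} X_s` of a process. -/
def runInf {Ω : Type*} (X : ℝ → Ω → ℝ) (t : ℝ) (ω : Ω) : ℝ :=
  sInf ((fun s => X s ω) '' Set.Icc 0 t)

/-- `G(x) = E[∫_0^∞ g(x + X_t) e^{-rt} dt]`. -/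
def Gfun {Ω : Type*} [MeasurableSpace Ω] (P : Measure Ω) (X : ℝ → Ω → ℝ)
    (g : ℝ → ℝ) (r x : ℝ) : ℝ :=
  ∫ ω, (∫ t in Set.Ici (0:ℝ), g (x + X t ω) * Real.exp (-r * t)) ∂P

/-- The Gittins index `κ(y) = ∫_0^∞ E[g(y + X̲_t)] e^{-rt} dt`. -/
def gittinsInf {Ω : Type*} [MeasurableSpace Ω] (P : Measure Ω) (X : ℝ → Ω → ℝ)
    (g : ℝ → ℝ) (r y : ℝ) : ℝ :=
  ∫ t in Set.Ici (0:ℝ), (∫ ω, g (y + runInf X t ω) ∂P) * Real.exp (-r * t)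

/-- The dual index `μ(y) = ∫_0^∞ E[g(y + X̄_t)] e^{-rt} dt`. -/
def gittinsSup {Ω : Type*} [MeasurableSpace Ω] (P : Measure Ω) (X : ℝ → Ω → ℝ)
    (g : ℝ → ℝ) (r y : ℝ) : ℝ :=
  ∫ t in Set.Ici (0:ℝ), (∫ ω, g (y + runSup X t ω) ∂P) * Real.exp (-r * t)

/-- An extended-real-valued stopping time of the filtration `F`. -/
def IsStopTimeE {Ω : Type*} {m : MeasurableSpace Ω} (F : Filtration ℝ m) (τ : Ω → ℝ≥0∞) : Prop :=
  ∀ t : ℝ, MeasurableSet[F t] {ω | τ ω ≤ ENNReal.ofReal t}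

/-- The payoff `E[∫_0^τ g(x + X_t)e^{-rt} dt + c e^{-rτ}]` of a stopping time `τ`
(with `e^{-rτ} = 0` on `{τ = ∞}`). -/
def gPayoff {Ω : Type*} [MeasurableSpace Ω] (P : Measure Ω) (X : ℝ → Ω → ℝ)
    (g : ℝ → ℝ) (x r c : ℝ) (τ : Ω → ℝ≥0∞) : ℝ :=
  ∫ ω, ((∫ t, Set.indicator {s : ℝ | 0 ≤ s ∧ ENNReal.ofReal s < τ ω}
        (fun s => g (x + X s ω) * Real.exp (-r * s)) t)
      + c * (if τ ω = ⊤ then (0:ℝ) else Real.exp (-r * (τ ω).toReal))) ∂P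

/-- The value function `v(x,c)` of the parameterised optimal stopping problem. -/
def stopValue {Ω : Type*} [m : MeasurableSpace Ω] (P : Measure Ω) (X : ℝ → Ω → ℝ)
    (hXsm : ∀ t, StronglyMeasurable (X t)) (g : ℝ → ℝ) (x r c : ℝ) : ℝ :=
  sInf {y : ℝ | ∃ τ : Ω → ℝ≥0∞,
    IsStopTimeE (Filtration.natural X hXsm) τ ∧ y = gPayoff P X g x r c τ}

open ProbabilityTheory Topology
open scoped Convolution

/-- The process `n ↦ (D 0, D 1, …)` has independent increments with common law `p`, relative to the
discrete filtration `G`. -/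
structure IsIIDStep {Ω : Type*} {m : MeasurableSpace Ω} (P : Measure Ω)
    (G : ℕ → MeasurableSpace Ω) (D : ℕ → Ω → ℝ) (p : Measure ℝ) : Prop where
  le : ∀ k, G k ≤ m
  mono : Monotone G
  meas : ∀ k, Measurable[G (k + 1)] (D k)
  law : ∀ k, P.map (D k) = p
  indep : ∀ k, Indep (MeasurableSpace.comap (D k) inferInstance) (G k) P

namespace IsIIDStep

variable {Ω : Type*} {m : MeasurableSpace Ω} {P : Measure Ω}
  {G : ℕ → MeasurableSpace Ω} {D : ℕ → Ω → ℝ} {p : Measure ℝ}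

lemma shift (h : IsIIDStep P G D p) (k : ℕ) :
    IsIIDStep P (fun j => G (k + j)) (fun j => D (k + j)) p where
  le j := h.le _
  mono _ _ hij := h.mono (by gcongr)
  meas j := h.meas _
  law j := h.law _
  indep j := h.indep _

lemma measurable (h : IsIIDStep P G D p) (k : ℕ) : Measurable (D k) :=
  (h.meas k).mono (h.le _) le_rfl

lemma measurable_path (h : IsIIDStep P G D p) : Measurable (fun ω k => D k ω) :=
  measurable_pi_lambda _ h.measurable

lemma measure_inter_cylinder (h : IsIIDStep P G D p) {A : Set Ω} (hA : MeasurableSet[G 0] A)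
    {B : ℕ → Set ℝ} (hB : ∀ i, MeasurableSet (B i)) (n : ℕ) :
    MeasurableSet[G n] (A ∩ ⋂ i ∈ Finset.range n, D i ⁻¹' B i) ∧
      P (A ∩ ⋂ i ∈ Finset.range n, D i ⁻¹' B i) = P A * ∏ i ∈ Finset.range n, p (B i) := by
  induction n with
  | zero => simpa using hA
  | succ n ih =>
    have e : (A ∩ ⋂ i ∈ Finset.range (n + 1), D i ⁻¹' B i)
        = D n ⁻¹' B n ∩ (A ∩ ⋂ i ∈ Finset.range n, D i ⁻¹' B i) := by
      rw [Finset.range_add_one, Finset.set_biInter_insert]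
      ac_rfl
    rw [e]
    refine ⟨MeasurableSet.inter (h.meas n (hB n)) (h.mono n.le_succ _ ih.1), ?_⟩
    rw [(Indep_iff _ _ _).1 (h.indep n) _ _ ⟨B n, hB n, rfl⟩ ih.1, ih.2, Finset.prod_range_succ,
      ← h.law n, Measure.map_apply (h.measurable n) (hB n)]
    ring

variable [IsProbabilityMeasure P]

lemma isProbabilityMeasure (h : IsIIDStep P G D p) : IsProbabilityMeasure p :=
  h.law 0 ▸ Measure.isProbabilityMeasure_map (h.measurable 0).aemeasurable

lemma map_restrict (h : IsIIDStep P G D p) {A : Set Ω} (hA : MeasurableSet[G 0] A) :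
    (P.restrict A).map (fun ω k => D k ω)
      = P A • (haveI := h.isProbabilityMeasure; Measure.infinitePi fun _ : ℕ => p) := by
  have := h.isProbabilityMeasure
  by_cases h0 : P A = 0
  · simp [h0, Measure.restrict_eq_zero.2 h0]
  have hne : P A ≠ ∞ := measure_ne_top _ _
  have key : (P A)⁻¹ • (P.restrict A).map (fun ω k => D k ω)
      = Measure.infinitePi fun _ : ℕ => p := by
    refine Measure.eq_infinitePi _ fun s t ht => ?_
    obtain ⟨n, hn⟩ := s.exists_nat_subset_range
    set B : ℕ → Set ℝ := fun i => if i ∈ s then t i else univ with hBdef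
    have hB : ∀ i, MeasurableSet (B i) := fun i => by
      by_cases hi : i ∈ s <;> simp [hBdef, hi, ht]
    have e : A ∩ (fun ω k => D k ω) ⁻¹' ((s : Set ℕ).pi t)
        = A ∩ ⋂ i ∈ Finset.range n, D i ⁻¹' B i := by
      ext ω
      simp only [Set.mem_inter_iff, Set.mem_preimage, Set.mem_pi, Set.mem_iInter, hBdef]
      refine and_congr_right fun _ => ⟨fun H i _ => ?_, fun H i hi => ?_⟩
      · by_cases his : i ∈ s
        · simpa [his] using H i his
        · simp [his]
      · have := H i (hn hi)
        have hi' : i ∈ s := hi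
        simpa [hi'] using this
    have hp : ∏ i ∈ Finset.range n, p (B i) = ∏ i ∈ s, p (t i) := by
      rw [← Finset.prod_subset hn]
      · exact Finset.prod_congr rfl fun i hi => by simp [hBdef, hi]
      · intro i _ hi
        simp [hBdef, hi]
    rw [Measure.smul_apply, Measure.map_apply h.measurable_path
      (MeasurableSet.pi s.countable_toSet fun i _ => ht i), Measure.restrict_apply
      (h.measurable_path (MeasurableSet.pi s.countable_toSet fun i _ => ht i)), Set.inter_comm, e,
      (h.measure_inter_cylinder hA hB n).2, hp, smul_eq_mul, ← mul_assoc,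
      ENNReal.inv_mul_cancel h0 hne, one_mul]
  rw [← key, smul_smul, ENNReal.mul_inv_cancel h0 hne, one_smul]

lemma map_path (h : IsIIDStep P G D p) :
    P.map (fun ω k => D k ω)
      = (haveI := h.isProbabilityMeasure; Measure.infinitePi fun _ : ℕ => p) := by
  have := h.map_restrict (A := univ) MeasurableSet.univ
  simpa using this

lemma indep_path (h : IsIIDStep P G D p) :
    Indep (G 0) (MeasurableSpace.comap (fun ω k => D k ω) inferInstance) P := by
  rw [Indep_iff]
  rintro A _ hA ⟨B, hB, rfl⟩
  have h1 := congrArg (fun μ => μ B) (h.map_restrict hA)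
  simp only [Measure.smul_apply, smul_eq_mul] at h1
  rw [← h.map_path, Measure.map_apply h.measurable_path hB, Measure.map_apply h.measurable_path hB,
    Measure.restrict_apply (h.measurable_path hB), Set.inter_comm] at h1
  exact h1

/-- The integral of a product of a past quantity and a functional of the increments factorizes. -/
lemma integral_mul (h : IsIIDStep P G D p) {f : Ω → ℂ} (hf : Measurable[G 0] f)
    {Φ : (ℕ → ℝ) → ℂ} (hΦ : Measurable Φ) :
    ∫ ω, f ω * Φ (fun k => D k ω) ∂P = (∫ ω, f ω ∂P) * ∫ ω, Φ (fun k => D k ω) ∂P := by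
  have hi : IndepFun f (fun ω => Φ (fun k => D k ω)) P := by
    refine indep_of_indep_of_le_left (indep_of_indep_of_le_right h.indep_path ?_) ?_
    · rintro _ ⟨s, hs, rfl⟩
      exact ⟨Φ ⁻¹' s, hΦ hs, rfl⟩
    · exact hf.comap_le
  exact hi.integral_fun_mul_eq_mul_integral
    (hf.mono (h.le 0) le_rfl).aestronglyMeasurable
    (hΦ.comp h.measurable_path).aestronglyMeasurable

/-- The law of the increments is a function of `p` only. -/
lemma integral_path_eq {Ω' : Type*} {m' : MeasurableSpace Ω'} {P' : Measure Ω'}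
    [IsProbabilityMeasure P'] {G' : ℕ → MeasurableSpace Ω'} {D' : ℕ → Ω' → ℝ}
    (h : IsIIDStep P G D p) (h' : IsIIDStep P' G' D' p) {Φ : (ℕ → ℝ) → ℂ} (hΦ : Measurable Φ) :
    ∫ ω, Φ (fun k => D k ω) ∂P = ∫ ω, Φ (fun k => D' k ω) ∂P' := by
  rw [← integral_map (φ := fun ω k => D k ω) h.measurable_path.aemeasurable
    hΦ.aestronglyMeasurable, ← integral_map (φ := fun ω k => D' k ω)
    h'.measurable_path.aemeasurable hΦ.aestronglyMeasurable, h.map_path, h'.map_path]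

/-- The law of the increments is invariant under permutations of the time index. -/
lemma integral_path_perm (h : IsIIDStep P G D p) (e : ℕ ≃ ℕ) {Φ : (ℕ → ℝ) → ℂ}
    (hΦ : Measurable Φ) :
    ∫ ω, Φ (fun k => D (e k) ω) ∂P = ∫ ω, Φ (fun k => D k ω) ∂P := by
  have := h.isProbabilityMeasure
  have hm : Measurable fun (d : ℕ → ℝ) k => d (e k) :=
    measurable_pi_lambda _ fun k => measurable_pi_apply _
  have hinv : (Measure.infinitePi fun _ : ℕ => p).map (fun (d : ℕ → ℝ) k => d (e k))
      = Measure.infinitePi fun _ : ℕ => p := by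
    refine Measure.eq_infinitePi _ fun s t ht => ?_
    rw [Measure.map_apply hm (MeasurableSet.pi s.countable_toSet fun i _ => ht i)]
    have : (fun (d : ℕ → ℝ) k => d (e k)) ⁻¹' ((s : Set ℕ).pi t)
        = ((s.map e.toEmbedding : Finset ℕ) : Set ℕ).pi (fun i => t (e.symm i)) := by
      ext d
      simp only [Set.mem_preimage, Set.mem_pi, Finset.coe_map, Set.mem_image, Finset.mem_coe]
      exact ⟨fun H i ⟨j, hj, hji⟩ => by subst hji; simpa using H j hj,
        fun H i hi => by simpa using H (e i) ⟨i, hi, rfl⟩⟩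
    rw [this, Measure.infinitePi_pi _ fun i _ => ht _, Finset.prod_map]
    simp
  have h1 : ∫ ω, Φ (fun k => D (e k) ω) ∂P
      = ∫ d, Φ (fun k => d (e k)) ∂(P.map (fun ω k => D k ω)) :=
    (integral_map (φ := fun ω k => D k ω) h.measurable_path.aemeasurable
      (hΦ.comp hm).aestronglyMeasurable).symm
  rw [h1, h.map_path, ← integral_map (φ := fun (d : ℕ → ℝ) k => d (e k)) hm.aemeasurable
    hΦ.aestronglyMeasurable, hinv, ← h.map_path,
    integral_map h.measurable_path.aemeasurable hΦ.aestronglyMeasurable]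

end IsIIDStep

/-- Partial sums of a sequence of steps. -/
def stepSum (d : ℕ → ℝ) (n : ℕ) : ℝ := ∑ j ∈ Finset.range n, d j

/-- Running maximum of the partial sums of a sequence of steps. -/
def stepMax (d : ℕ → ℝ) (n : ℕ) : ℝ := partialSups (stepSum d) n

/-- Running minimum of the partial sums of a sequence of steps. -/
def stepMin (d : ℕ → ℝ) (n : ℕ) : ℝ := -stepMax (-d) n

lemma stepSum_zero (d : ℕ → ℝ) : stepSum d 0 = 0 := by simp [stepSum]

lemma stepSum_neg (d : ℕ → ℝ) (n : ℕ) : stepSum (-d) n = -stepSum d n := by simp [stepSum]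

lemma stepSum_add (d : ℕ → ℝ) (k m : ℕ) :
    stepSum d (k + m) = stepSum d k + stepSum (fun j => d (k + j)) m := by
  simp [stepSum, Finset.sum_range_add]

lemma measurable_stepSum (n : ℕ) : Measurable fun d : ℕ → ℝ => stepSum d n := by
  unfold stepSum
  fun_prop

lemma measurable_stepMax (n : ℕ) : Measurable fun d : ℕ → ℝ => stepMax d n := by
  unfold stepMax
  induction n with
  | zero => simpa using measurable_stepSum 0
  | succ n ih =>
    simp only [← Order.succ_eq_add_one, partialSups_succ]
    exact ih.sup (measurable_stepSum _)

lemma measurable_stepMin (n : ℕ) : Measurable fun d : ℕ → ℝ => stepMin d n :=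
  ((measurable_stepMax n).comp measurable_neg).neg

/-- Decomposition over the first time at which the running maximum is attained. -/
lemma sum_antidiagonal_first_max (d : ℕ → ℝ) (n : ℕ) (φ : ℝ → ℂ) :
    ∑ km ∈ Finset.HasAntidiagonal.antidiagonal n,
      ({d : ℕ → ℝ | ∀ j < km.1, stepSum d j < stepSum d km.1}.indicator 1 d : ℂ)
        * ({d : ℕ → ℝ | ∀ j ≤ km.2, stepSum d j ≤ 0}.indicator 1 fun j => d (km.1 + j))
        * φ (stepSum d km.1) = φ (stepMax d n) := by
  classical
  have hex : ∃ k, k ≤ n ∧ stepMax d n = stepSum d k := exists_partialSups_eq _ _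
  set k := Nat.find hex with hk
  obtain ⟨hkn, hkmax⟩ := Nat.find_spec hex
  rw [← hk] at hkn hkmax
  have hle : ∀ j ≤ n, stepSum d j ≤ stepSum d k := fun j hj =>
    (le_partialSups_of_le (stepSum d) hj).trans hkmax.le
  have hlt : ∀ j < k, stepSum d j < stepSum d k := fun j hj => by
    refine lt_of_le_of_ne (hle j (by lia)) fun h => Nat.find_min hex hj ⟨by lia, ?_⟩
    rw [hkmax, h]
  rw [Finset.sum_eq_single (k, n - k)]
  · rw [Set.indicator_of_mem (by exact hlt), Set.indicator_of_mem, hkmax]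
    · simp
    · intro j hj
      have := hle (k + j) (by simp only at hj; lia)
      rw [stepSum_add] at this
      linarith
  · rintro ⟨a, b⟩ hab hne
    rw [Finset.HasAntidiagonal.mem_antidiagonal] at hab
    have hak : a ≠ k := by
      rintro rfl
      exact hne (by ext <;> simp; lia)
    rcases lt_or_gt_of_ne hak with h | h
    · rw [Set.indicator_of_notMem (s := {d : ℕ → ℝ | ∀ j ≤ _, stepSum d j ≤ 0})]
      · simp
      · intro H
        have h1 := H (k - a) (by simp only; lia)
        have h2 := hlt a h
        have h3 := stepSum_add d a (k - a)
        rw [show a + (k - a) = k by lia] at h3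
        simp only at h1
        linarith
    · rw [Set.indicator_of_notMem]
      · simp
      · intro H
        exact absurd (H k h) (not_lt.2 (hle a (by lia)))
  · intro h
    exact absurd (Finset.HasAntidiagonal.mem_antidiagonal.2 (by simp; lia)) h

/-- The permutation of `ℕ` reversing `{0, …, n - 1}`. -/
def revBelow (n : ℕ) : ℕ ≃ ℕ :=
  Function.Involutive.toPerm (fun j => if j < n then n - 1 - j else j) fun j => by
    by_cases h : j < n
    · simp only [h, if_true, show n - 1 - j < n by lia]
      lia
    · simp [h]

lemma revBelow_apply (n j : ℕ) : revBelow n j = if j < n then n - 1 - j else j := rfl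

lemma stepSum_revBelow (d : ℕ → ℝ) {n k : ℕ} (hk : k ≤ n) :
    stepSum (fun j => d (revBelow n j)) k = stepSum d n - stepSum d (n - k) := by
  have h1 : stepSum (fun j => d (revBelow n j)) k
      = ∑ j ∈ Finset.range k, d (n - k + (k - 1 - j)) := by
    refine Finset.sum_congr rfl fun j hj => ?_
    rw [Finset.mem_range] at hj
    simp only [revBelow_apply, show j < n by lia, if_true]
    congr 1
    lia
  have h2 := stepSum_add d (n - k) k
  rw [Nat.sub_add_cancel hk] at h2
  rw [h1, h2, Finset.sum_range_reflect (fun j => d (n - k + j)) k]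
  simp [stepSum]

lemma stepMin_revBelow (d : ℕ → ℝ) (n : ℕ) :
    stepMin (fun j => d (revBelow n j)) n = stepSum d n - stepMax d n := by
  have key : ∀ k ≤ n, stepSum (-fun j => d (revBelow n j)) k
      = stepSum d (n - k) - stepSum d n := fun k hk => by
    rw [stepSum_neg, stepSum_revBelow d hk]
    ring
  have : stepMax (-fun j => d (revBelow n j)) n = stepMax d n - stepSum d n := by
    apply le_antisymm
    · refine partialSups_le _ _ _ fun k hk => ?_
      rw [key k hk]
      gcongr
      exact le_partialSups_of_le _ (n.sub_le k)
    · rw [sub_le_iff_le_add]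
      refine partialSups_le _ _ _ fun k hk => ?_
      rw [← sub_le_iff_le_add, show k = n - (n - k) by lia, ← key _ (n.sub_le k)]
      exact le_partialSups_of_le _ (n.sub_le k)
  rw [stepMin, this]
  ring

namespace IsIIDStep

variable {Ω : Type*} {m : MeasurableSpace Ω} {P : Measure Ω}
  {G : ℕ → MeasurableSpace Ω} {D : ℕ → Ω → ℝ} {p : Measure ℝ}

lemma measurable_stepSum_path (h : IsIIDStep P G D p) {j k : ℕ} (hjk : j ≤ k) :
    Measurable[G k] fun ω => stepSum (fun i => D i ω) j := by
  unfold stepSum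
  exact Finset.measurable_fun_sum _ fun i hi =>
    (h.meas i).mono (h.mono (by have := Finset.mem_range.1 hi; lia)) le_rfl

variable [IsProbabilityMeasure P]

lemma integral_exp_max (h : IsIIDStep P G D p) (u v : ℝ) (n : ℕ) :
    ∫ ω, Complex.exp (u * stepMax (fun k => D k ω) n * Complex.I)
        * Complex.exp (v * (stepSum (fun k => D k ω) n - stepMax (fun k => D k ω) n : ℝ)
          * Complex.I) ∂P
      = ∑ km ∈ Finset.HasAntidiagonal.antidiagonal n,
        (∫ ω, ({d : ℕ → ℝ | ∀ j < km.1, stepSum d j < stepSum d km.1}.indicator 1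
            (fun k => D k ω) : ℂ)
          * Complex.exp (u * stepSum (fun k => D k ω) km.1 * Complex.I) ∂P)
        * ∫ ω, ({d : ℕ → ℝ | ∀ j ≤ km.2, stepSum d j ≤ 0}.indicator 1 (fun k => D k ω) : ℂ)
          * Complex.exp (v * stepSum (fun k => D k ω) km.2 * Complex.I) ∂P := by
  have hA : ∀ k, MeasurableSet {d : ℕ → ℝ | ∀ j < k, stepSum d j < stepSum d k} := fun k => by
    simp only [Set.ofPred_forall]
    exact .iInter fun j => .iInter fun _ =>
      measurableSet_lt (measurable_stepSum j) (measurable_stepSum k)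
  have hB : ∀ k, MeasurableSet {d : ℕ → ℝ | ∀ j ≤ k, stepSum d j ≤ 0} := fun k => by
    simp only [Set.ofPred_forall]
    exact .iInter fun j => .iInter fun _ => measurableSet_le (measurable_stepSum j)
      measurable_const
  have hΦ : ∀ k, Measurable fun d : ℕ → ℝ =>
      ({d : ℕ → ℝ | ∀ j ≤ k, stepSum d j ≤ 0}.indicator 1 d : ℂ)
        * Complex.exp (v * stepSum d k * Complex.I) := fun k => by
    have := measurable_stepSum k
    exact (measurable_one.indicator (hB k)).mul (by fun_prop)
  have hF : ∀ k, Measurable[G k] fun ω =>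
      ({d : ℕ → ℝ | ∀ j < k, stepSum d j < stepSum d k}.indicator 1 (fun k => D k ω) : ℂ)
        * Complex.exp (u * stepSum (fun k => D k ω) k * Complex.I) := fun k => by
    let _ : MeasurableSpace Ω := G k
    have h0 : Measurable fun ω => stepSum (fun i => D i ω) k :=
      h.measurable_stepSum_path (le_refl k)
    have hset : MeasurableSet[G k]
        {ω | ∀ j < k, stepSum (fun i => D i ω) j < stepSum (fun i => D i ω) k} := by
      simp only [Set.ofPred_forall]
      exact .iInter fun j => .iInter fun hj =>
        measurableSet_lt (h.measurable_stepSum_path hj.le) h0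
    exact (measurable_one.indicator hset).mul
      ((((Complex.measurable_ofReal.comp h0).const_mul _).mul_const _).cexp)
  have hterm : ∀ k l : ℕ, 
      (∫ ω, ({d : ℕ → ℝ | ∀ j < k, stepSum d j < stepSum d k}.indicator 1
            (fun k => D k ω) : ℂ)
          * Complex.exp (u * stepSum (fun k => D k ω) k * Complex.I) ∂P)
        * (∫ ω, ({d : ℕ → ℝ | ∀ j ≤ l, stepSum d j ≤ 0}.indicator 1 (fun k => D k ω) : ℂ)
          * Complex.exp (v * stepSum (fun k => D k ω) l * Complex.I) ∂P)
      = ∫ ω, (({d : ℕ → ℝ | ∀ j < k, stepSum d j < stepSum d k}.indicator 1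
            (fun k => D k ω) : ℂ)
          * Complex.exp (u * stepSum (fun k => D k ω) k * Complex.I))
        * (({d : ℕ → ℝ | ∀ j ≤ l, stepSum d j ≤ 0}.indicator 1 (fun j => D (k + j) ω) : ℂ)
          * Complex.exp (v * stepSum (fun j => D (k + j) ω) l * Complex.I)) ∂P := fun k l => by
    rw [(h.shift k).integral_mul (hF k) (hΦ l), (h.shift k).integral_path_eq h (hΦ l)]
  have hnorm : ∀ (s : Set (ℕ → ℝ)) (d : ℕ → ℝ) (a b : ℝ),
      ‖(s.indicator 1 d : ℂ) * Complex.exp (a * b * Complex.I)‖ ≤ 1 := fun s d a b => by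
    rw [norm_mul, ← Complex.ofReal_mul, Complex.norm_exp_ofReal_mul_I, mul_one]
    by_cases hd : d ∈ s <;> simp [hd]
  simp only [hterm]
  rw [← integral_finsetSum]
  · refine integral_congr_ae (.of_forall fun ω => ?_)
    simp only
    rw [← sum_antidiagonal_first_max (fun k => D k ω) n fun M =>
      Complex.exp (u * M * Complex.I)
        * Complex.exp (v * (stepSum (fun k => D k ω) n - M : ℝ) * Complex.I)]
    refine Finset.sum_congr rfl fun km hkm => ?_
    rw [Finset.HasAntidiagonal.mem_antidiagonal] at hkm
    have : stepSum (fun k => D k ω) n - stepSum (fun k => D k ω) km.1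
        = stepSum (fun j => D (km.1 + j) ω) km.2 := by
      rw [← hkm, stepSum_add]
      ring
    rw [this]
    ring
  · intro km _
    refine Integrable.of_bound (C := 1) ?_ (.of_forall fun ω => ?_)
    · exact (((hF km.1).mono (h.le _) le_rfl).mul
        ((hΦ km.2).comp (h.shift km.1).measurable_path)).aestronglyMeasurable
    · rw [norm_mul]
      exact mul_le_one₀ (hnorm _ _ _ _) (norm_nonneg _) (hnorm _ _ _ _)

lemma integral_exp_stepSum_sub_stepMax (h : IsIIDStep P G D p) (v : ℝ) (n : ℕ) :
    ∫ ω, Complex.exp (v * (stepSum (fun k => D k ω) n - stepMax (fun k => D k ω) n : ℝ)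
          * Complex.I) ∂P
      = ∫ ω, Complex.exp (v * stepMin (fun k => D k ω) n * Complex.I) ∂P := by
  have hΦ : Measurable fun d : ℕ → ℝ => Complex.exp (v * stepMin d n * Complex.I) := by
    have := measurable_stepMin n
    fun_prop
  rw [← h.integral_path_perm (revBelow n) hΦ]
  refine integral_congr_ae (.of_forall fun ω => ?_)
  simp only
  rw [stepMin_revBelow (fun k => D k ω) n]

/-- Discrete Wiener–Hopf factorization at a geometric time. -/
lemma wienerHopf (h : IsIIDStep P G D p) {q : ℝ} (hq0 : 0 ≤ q) (hq1 : q < 1) (θ : ℝ) :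
    (1 - q) * ∑' n : ℕ, (q : ℂ) ^ n
        * ∫ ω, Complex.exp (θ * stepSum (fun k => D k ω) n * Complex.I) ∂P
      = ((1 - q) * ∑' n : ℕ, (q : ℂ) ^ n
        * ∫ ω, Complex.exp (θ * stepMax (fun k => D k ω) n * Complex.I) ∂P)
      * ((1 - q) * ∑' n : ℕ, (q : ℂ) ^ n
        * ∫ ω, Complex.exp (θ * stepMin (fun k => D k ω) n * Complex.I) ∂P) := by
  set α : ℝ → ℕ → ℂ := fun u k => (q : ℂ) ^ k *
    ∫ ω, ({d : ℕ → ℝ | ∀ j < k, stepSum d j < stepSum d k}.indicator 1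
            (fun k => D k ω) : ℂ)
          * Complex.exp (u * stepSum (fun k => D k ω) k * Complex.I) ∂P with hα
  set β : ℝ → ℕ → ℂ := fun v l => (q : ℂ) ^ l *
    ∫ ω, ({d : ℕ → ℝ | ∀ j ≤ l, stepSum d j ≤ 0}.indicator 1 (fun k => D k ω) : ℂ)
          * Complex.exp (v * stepSum (fun k => D k ω) l * Complex.I) ∂P with hβ
  have hb : ∀ (s : Set (ℕ → ℝ)) (a : ℝ) (k : ℕ),
      ‖∫ ω, (s.indicator 1 (fun k => D k ω) : ℂ)
          * Complex.exp (a * stepSum (fun k => D k ω) k * Complex.I) ∂P‖ ≤ 1 := fun s a k => by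
    refine (norm_integral_le_of_norm_le_const (C := 1) (.of_forall fun ω => ?_)).trans (by simp)
    rw [norm_mul, ← Complex.ofReal_mul, Complex.norm_exp_ofReal_mul_I, mul_one]
    by_cases hd : (fun k => D k ω) ∈ s <;> simp [hd]
  have hgeo := summable_geometric_of_lt_one hq0 hq1
  have hsα : ∀ u, Summable fun k => ‖α u k‖ := fun u => by
    refine Summable.of_nonneg_of_le (fun _ => norm_nonneg _) (fun k => ?_) hgeo
    rw [hα, norm_mul, norm_pow, Complex.norm_real, Real.norm_of_nonneg hq0]
    exact mul_le_of_le_one_right (by positivity) (hb _ _ _)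
  have hsβ : ∀ u, Summable fun k => ‖β u k‖ := fun u => by
    refine Summable.of_nonneg_of_le (fun _ => norm_nonneg _) (fun k => ?_) hgeo
    rw [hβ, norm_mul, norm_pow, Complex.norm_real, Real.norm_of_nonneg hq0]
    exact mul_le_of_le_one_right (by positivity) (hb _ _ _)
  have key : ∀ u v : ℝ, (∑' n : ℕ, (q : ℂ) ^ n *
      ∫ ω, Complex.exp (u * stepMax (fun k => D k ω) n * Complex.I)
        * Complex.exp (v * (stepSum (fun k => D k ω) n - stepMax (fun k => D k ω) n : ℝ)
          * Complex.I) ∂P) = (∑' k, α u k) * ∑' l, β v l := fun u v => by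
    rw [tsum_mul_tsum_eq_tsum_sum_antidiagonal_of_summable_norm (hsα u) (hsβ v)]
    refine tsum_congr fun n => ?_
    rw [h.integral_exp_max u v n, Finset.mul_sum]
    refine Finset.sum_congr rfl fun km hkm => ?_
    rw [Finset.HasAntidiagonal.mem_antidiagonal] at hkm
    simp only [hα, hβ]
    rw [← hkm, pow_add]
    ring
  have h1 := key θ θ
  have h2 := key θ 0
  have h3 := key 0 θ
  have h4 := key 0 0
  simp only [Complex.ofReal_zero, zero_mul, Complex.exp_zero, mul_one, one_mul,
    integral_const, probReal_univ, one_smul] at h2 h3 h4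
  rw [tsum_geometric_of_norm_lt_one (by simpa [abs_of_nonneg hq0] using hq1)] at h4
  simp only [h.integral_exp_stepSum_sub_stepMax] at h3
  have h1' : ∀ n : ℕ, ∫ ω, Complex.exp (θ * stepMax (fun k => D k ω) n * Complex.I)
        * Complex.exp (θ * (stepSum (fun k => D k ω) n - stepMax (fun k => D k ω) n : ℝ)
          * Complex.I) ∂P
      = ∫ ω, Complex.exp (θ * stepSum (fun k => D k ω) n * Complex.I) ∂P := fun n => by
    refine integral_congr_ae (.of_forall fun ω => ?_)
    simp only
    rw [← Complex.exp_add]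
    congr 1
    push_cast
    ring
  simp only [h1'] at h1
  rw [h1, h2, h3]
  have hq : (1 - q : ℂ) ≠ 0 := by
    rw [← Complex.ofReal_one, ← Complex.ofReal_sub]
    exact_mod_cast (sub_pos.2 hq1).ne'
  have h5 : (1 - q : ℂ) * ((∑' k, α 0 k) * ∑' l, β 0 l) = 1 := by
    rw [← h4, mul_inv_cancel₀ hq]
  linear_combination (-(1 - q : ℂ) * ((∑' k, α θ k) * ∑' l, β θ l)) * h5

end IsIIDStep

/-- Right-continuous paths with left limits. -/
structure IsCadlag (f : ℝ → ℝ) : Prop where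
  rightCont : ∀ t, ContinuousWithinAt f (Ici t) t
  leftLim : ∀ t, ∃ L, Tendsto f (𝓝[<] t) (𝓝 L)

/-- Supremum of a path over a compact interval. -/
def supIcc (f : ℝ → ℝ) (s t : ℝ) : ℝ := sSup (f '' Icc s t)

/-- A sequence of mesh sizes. -/
def mesh (n : ℕ) : ℝ := 1 / (n + 1)

lemma mesh_pos (n : ℕ) : 0 < mesh n := Nat.one_div_pos_of_nat

lemma tendsto_mesh : Tendsto mesh atTop (𝓝 0) := tendsto_one_div_add_atTop_nhds_zero_nat

/-- The index of the first point of the grid `δ ℕ` lying strictly after `t`. -/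
def gridIdx (δ t : ℝ) : ℕ := ⌊t / δ⌋₊ + 1

lemma lt_gridIdx_mul {δ : ℝ} (hδ : 0 < δ) (t : ℝ) : t < gridIdx δ t * δ := by
  rw [← div_lt_iff₀ hδ, gridIdx]
  exact_mod_cast Nat.lt_floor_add_one (t / δ)

lemma gridIdx_mul_le {δ t : ℝ} (hδ : 0 < δ) (ht : 0 ≤ t) : gridIdx δ t * δ ≤ t + δ := by
  have := Nat.floor_le (div_nonneg ht hδ.le)
  rw [le_div_iff₀ hδ] at this
  rw [gridIdx]
  push_cast
  linarith

lemma gridIdx_mono {δ : ℝ} (hδ : 0 < δ) {s t : ℝ} (h : s ≤ t) : gridIdx δ s ≤ gridIdx δ t := by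
  unfold gridIdx
  gcongr

lemma tendsto_gridIdx_mul {t : ℝ} (ht : 0 ≤ t) :
    Tendsto (fun n => gridIdx (mesh n) t * mesh n) atTop (𝓝[≥] t) := by
  refine tendsto_nhdsWithin_iff.2 ⟨?_, .of_forall fun n => (lt_gridIdx_mul (mesh_pos n) t).le⟩
  refine tendsto_of_tendsto_of_tendsto_of_le_of_le tendsto_const_nhds
    (by simpa using tendsto_mesh.const_add t) (fun n => (lt_gridIdx_mul (mesh_pos n) t).le)
    fun n => gridIdx_mul_le (mesh_pos n) ht

namespace IsCadlag

variable {f : ℝ → ℝ}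

lemma neg (hf : IsCadlag f) : IsCadlag (-f) where
  rightCont t := (hf.rightCont t).neg
  leftLim t := (hf.leftLim t).imp' _ fun _ h => h.neg

lemma bddAbove (hf : IsCadlag f) (s t : ℝ) : BddAbove (f '' Icc s t) := by
  refine isCompact_Icc.induction_on (p := fun u => BddAbove (f '' u)) (by simp)
    (fun u v huv h => h.mono (image_mono huv)) (fun u v hu hv => by
      rw [image_union]; exact hu.union hv) fun a _ => ?_
  obtain ⟨L, hL⟩ := hf.leftLim a
  have h1 : ∀ᶠ u in 𝓝[<] a, f u < max (f a) L + 1 :=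
    hL.eventually_lt_const (by linarith [le_max_right (f a) L])
  have h2 : ∀ᶠ u in 𝓝[≥] a, f u < max (f a) L + 1 :=
    (hf.rightCont a).eventually_lt_const (by linarith [le_max_left (f a) L])
  have h3 : ∀ᶠ u in 𝓝 a, f u < max (f a) L + 1 := by
    rw [← nhdsLT_sup_nhdsGE, eventually_sup]
    exact ⟨h1, h2⟩
  refine ⟨_, nhdsWithin_le_nhds h3, max (f a) L + 1, ?_⟩
  rintro _ ⟨u, hu, rfl⟩
  exact le_of_lt hu

lemma le_supIcc (hf : IsCadlag f) {s t u : ℝ} (hu : u ∈ Icc s t) : f u ≤ supIcc f s t :=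
  le_csSup (hf.bddAbove s t) (mem_image_of_mem f hu)

lemma supIcc_mono (hf : IsCadlag f) {s t s' t' : ℝ} (hs : s' ≤ s) (h : s ≤ t) (ht : t ≤ t') :
    supIcc f s t ≤ supIcc f s' t' :=
  csSup_le_csSup (hf.bddAbove _ _) ((nonempty_Icc.2 h).image f)
    (image_mono (Icc_subset_Icc hs ht))

lemma tendsto_gridIdx (hf : IsCadlag f) {s t : ℝ} (h : s ≤ t) :
    Tendsto (fun n => f (s + gridIdx (mesh n) (t - s) * mesh n)) atTop (𝓝 (f t)) := by
  refine (hf.rightCont t).tendsto.comp (tendsto_nhdsWithin_iff.2 ⟨?_, .of_forall fun n => ?_⟩)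
  · have := ((tendsto_gridIdx_mul (sub_nonneg.2 h)).mono_right nhdsWithin_le_nhds).const_add s
    simpa using this
  · have := lt_gridIdx_mul (mesh_pos n) (t - s)
    exact show t ≤ _ by linarith

lemma tendsto_supIcc_right (hf : IsCadlag f) (s : ℝ) :
    Tendsto (fun t => supIcc f s t) (𝓝[≥] s) (𝓝 (f s)) := by
  refine tendsto_order.2 ⟨fun a ha => ?_, fun a ha => ?_⟩
  · filter_upwards [self_mem_nhdsWithin] with t ht
    exact ha.trans_le (hf.le_supIcc ⟨le_rfl, ht⟩)
  · obtain ⟨b, hb, hba⟩ := exists_between ha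
    have h1 := (hf.rightCont s).eventually_lt_const hb
    obtain ⟨u, hu, hsub⟩ := mem_nhdsGE_iff_exists_Ico_subset.1 h1
    filter_upwards [Ico_mem_nhdsGE hu] with t ht
    refine lt_of_le_of_lt (csSup_le ((nonempty_Icc.2 ht.1).image f) ?_) hba
    rintro _ ⟨v, hv, rfl⟩
    exact le_of_lt (hsub ⟨hv.1, hv.2.trans_lt ht.2⟩)

lemma tendsto_stepMax (hf : IsCadlag f) {s t : ℝ} (h : s ≤ t) :
    Tendsto (fun n => partialSups (fun k : ℕ => f (s + k * mesh n)) (gridIdx (mesh n) (t - s)))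
      atTop (𝓝 (supIcc f s t)) := by
  refine tendsto_order.2 ⟨fun a ha => ?_, fun a ha => ?_⟩
  · obtain ⟨_, ⟨u, hu, rfl⟩, hau⟩ := exists_lt_of_lt_csSup ((nonempty_Icc.2 h).image f) ha
    filter_upwards [(hf.tendsto_gridIdx hu.1).eventually_const_lt hau] with n hn
    exact hn.trans_le (le_partialSups_of_le (fun k : ℕ => f (s + k * mesh n))
      (gridIdx_mono (mesh_pos n) (by linarith [hu.2])))
  · filter_upwards [(hf.tendsto_gridIdx h).eventually_lt_const
      ((hf.le_supIcc ⟨h, le_rfl⟩).trans_lt ha)] with n hn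
    obtain ⟨k, hk, he⟩ := exists_partialSups_eq (fun k : ℕ => f (s + k * mesh n))
      (gridIdx (mesh n) (t - s))
    rw [he]
    rcases hk.lt_or_eq with hk | rfl
    · refine (hf.le_supIcc ⟨?_, ?_⟩).trans_lt ha
      · have := mesh_pos n
        simp only [le_add_iff_nonneg_right]
        positivity
      · have h1 : (k : ℝ) ≤ (t - s) / mesh n :=
          (Nat.cast_le.2 (Nat.lt_add_one_iff.1 hk)).trans
            (Nat.floor_le (div_nonneg (sub_nonneg.2 h) (mesh_pos n).le))
        rw [le_div_iff₀ (mesh_pos n)] at h1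
        linarith
    · exact hn

end IsCadlag

/-- Increments of a path along the grid of mesh `δ` started at `s`. -/
def gridStep (f : ℝ → ℝ) (s δ : ℝ) (j : ℕ) : ℝ := f (s + (j + 1 : ℕ) * δ) - f (s + j * δ)

lemma stepSum_gridStep (f : ℝ → ℝ) (s δ : ℝ) (n : ℕ) :
    stepSum (gridStep f s δ) n = f (s + n * δ) - f s := by
  have := Finset.sum_range_sub (fun j : ℕ => f (s + j * δ)) n
  simpa [stepSum, gridStep] using this

lemma gridStep_neg (f : ℝ → ℝ) (s δ : ℝ) : gridStep (-f) s δ = -gridStep f s δ := by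
  ext j
  simp [gridStep]
  ring

lemma stepMax_gridStep (f : ℝ → ℝ) (s δ : ℝ) (n : ℕ) :
    stepMax (gridStep f s δ) n = partialSups (fun k : ℕ => f (s + k * δ)) n - f s := by
  unfold stepMax
  induction n with
  | zero => simp [stepSum_zero]
  | succ n ih =>
    simp only [← Order.succ_eq_add_one, partialSups_succ, ih, stepSum_gridStep]
    exact (max_sub_sub_right _ _ _)

lemma IsCadlag.tendsto_stepMax_gridStep {f : ℝ → ℝ} (hf : IsCadlag f) {s t : ℝ} (h : s ≤ t) :
    Tendsto (fun n => stepMax (gridStep f s (mesh n)) (gridIdx (mesh n) (t - s)))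
      atTop (𝓝 (supIcc f s t - f s)) := by
  simp only [stepMax_gridStep]
  exact (hf.tendsto_stepMax h).sub_const _

lemma IsCadlag.tendsto_stepMin_gridStep {f : ℝ → ℝ} (hf : IsCadlag f) {s t : ℝ} (h : s ≤ t) :
    Tendsto (fun n => stepMin (gridStep f s (mesh n)) (gridIdx (mesh n) (t - s)))
      atTop (𝓝 (sInf (f '' Icc s t) - f s)) := by
  have := (hf.neg.tendsto_stepMax_gridStep h).neg
  simp only [gridStep_neg] at this
  have e : -(supIcc (-f) s t - (-f) s) = sInf (f '' Icc s t) - f s := by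
    rw [Real.sInf_def, supIcc]
    have : -(f '' Icc s t) = (-f) '' Icc s t := by
      rw [← Set.image_neg_eq_neg, Set.image_image]
      rfl
    rw [this, Pi.neg_apply]
    ring
  rwa [e] at this

lemma IsCadlag.tendsto_stepSum_gridStep {f : ℝ → ℝ} (hf : IsCadlag f) {s t : ℝ} (h : s ≤ t) :
    Tendsto (fun n => stepSum (gridStep f s (mesh n)) (gridIdx (mesh n) (t - s)))
      atTop (𝓝 (f t - f s)) := by
  simp only [stepSum_gridStep]
  exact (hf.tendsto_gridIdx h).sub_const _

/-- The exponential law of rate `r`. -/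
def expLaw (r : ℝ) : Measure ℝ :=
  ((volume : Measure ℝ).restrict (Ici 0)).withDensity
    fun t => ENNReal.ofReal (r * Real.exp (-r * t))

lemma measurable_expLaw_density (r : ℝ) :
    Measurable fun t : ℝ => ENNReal.ofReal (r * Real.exp (-r * t)) := by fun_prop

lemma expLaw_absolutelyContinuous (r : ℝ) : expLaw r ≪ volume :=
  (withDensity_absolutelyContinuous _ _).trans Measure.absolutelyContinuous_restrict

lemma ae_expLaw_nonneg (r : ℝ) : ∀ᵐ t ∂expLaw r, 0 ≤ t :=
  (withDensity_absolutelyContinuous _ _).ae_le (ae_restrict_mem measurableSet_Ici)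

lemma expLaw_Ici {r : ℝ} (hr : 0 < r) {a : ℝ} (ha : 0 ≤ a) :
    expLaw r (Ici a) = ENNReal.ofReal (Real.exp (-r * a)) := by
  have hi : IntegrableOn (fun t => r * Real.exp (-r * t)) (Ici a) :=
    (integrableOn_Ici_iff_integrableOn_Ioi).2 ((exp_neg_integrableOn_Ioi a hr).const_mul r)
  rw [expLaw, withDensity_apply _ measurableSet_Ici, Measure.restrict_restrict measurableSet_Ici,
    inter_eq_self_of_subset_left (Ici_subset_Ici.2 ha), ← ofReal_integral_eq_lintegral_ofReal hi
    (.of_forall fun t => by positivity), integral_Ici_eq_integral_Ioi, integral_const_mul,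
    integral_exp_mul_Ioi (neg_lt_zero.2 hr)]
  congr 1
  field_simp

lemma expLaw_Ici_neg {r : ℝ} {a : ℝ} (ha : a ≤ 0) : expLaw r (Ici a) = expLaw r (Ici 0) :=
  measure_congr <| by
    filter_upwards [ae_expLaw_nonneg r] with t ht
    exact propext ⟨fun _ => ht, fun _ => ha.trans ht⟩

lemma isProbabilityMeasure_expLaw {r : ℝ} (hr : 0 < r) : IsProbabilityMeasure (expLaw r) := by
  constructor
  have h : expLaw r univ = expLaw r (Ici 0) := measure_congr <| by
    filter_upwards [ae_expLaw_nonneg r] with t ht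
    exact propext ⟨fun _ => ht, fun _ => trivial⟩
  rw [h, expLaw_Ici hr le_rfl]
  simp

/-- The exponential law is memoryless. -/
lemma expLaw_restrict_Ici {r : ℝ} (hr : 0 < r) {s : ℝ} (hs : 0 ≤ s) :
    (expLaw r).restrict (Ici s)
      = ENNReal.ofReal (Real.exp (-r * s)) • (expLaw r).map (fun t => s + t) := by
  have := isProbabilityMeasure_expLaw hr
  refine Measure.ext_of_Ici _ _ fun a => ?_
  have e : (fun t => s + t) ⁻¹' Ici a = Ici (a - s) := by
    ext t
    simp [add_comm]
  rw [Measure.restrict_apply measurableSet_Ici, Ici_inter_Ici, Measure.smul_apply,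
    Measure.map_apply (by fun_prop) measurableSet_Ici, e, smul_eq_mul]
  rcases le_total a s with h | h
  · rw [sup_of_le_right h, expLaw_Ici_neg (sub_nonpos.2 h), expLaw_Ici hr hs,
      expLaw_Ici hr le_rfl]
    simp
  · rw [sup_of_le_left h, expLaw_Ici hr (hs.trans h), expLaw_Ici hr (sub_nonneg.2 h),
      ← ENNReal.ofReal_mul (by positivity), ← Real.exp_add]
    congr 2
    ring

lemma setIntegral_Ici_expLaw {E : Type*} [NormedAddCommGroup E] [NormedSpace ℝ E] {r : ℝ}
    (hr : 0 < r) {s : ℝ} (hs : 0 ≤ s) (f : ℝ → E) :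
    ∫ t in Ici s, f t ∂expLaw r = Real.exp (-r * s) • ∫ t, f (s + t) ∂expLaw r := by
  rw [expLaw_restrict_Ici hr hs, integral_smul_measure,
    (measurableEmbedding_addLeft s).integral_map, ENNReal.toReal_ofReal (by positivity)]

lemma integral_expLaw {E : Type*} [NormedAddCommGroup E] [NormedSpace ℝ E] {r : ℝ} (hr : 0 < r)
    (f : ℝ → E) :
    ∫ t, f t ∂expLaw r = ∫ t in Ici 0, (r * Real.exp (-r * t)) • f t := by
  rw [expLaw, integral_withDensity_eq_integral_toReal_smul (measurable_expLaw_density r)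
    (.of_forall fun _ => ENNReal.ofReal_lt_top)]
  refine integral_congr_ae (.of_forall fun t => ?_)
  simp only
  rw [ENNReal.toReal_ofReal (by positivity)]

lemma expLaw_floor_real {r : ℝ} (hr : 0 < r) {δ : ℝ} (hδ : 0 < δ) (n : ℕ) :
    ((expLaw r).map fun t => ⌊t / δ⌋₊).real {n}
      = (1 - Real.exp (-r * δ)) * Real.exp (-r * δ) ^ n := by
  have := isProbabilityMeasure_expLaw hr
  have hm : Measurable fun t : ℝ => ⌊t / δ⌋₊ := Nat.measurable_floor.comp (by fun_prop)
  have hI : ∀ n : ℕ, ((expLaw r).map fun t => ⌊t / δ⌋₊).real (Ici n)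
      = Real.exp (-r * δ) ^ n := fun n => by
    have e : (fun t : ℝ => ⌊t / δ⌋₊) ⁻¹' Ici n =ᵐ[expLaw r] Ici (n * δ) := by
      filter_upwards [ae_expLaw_nonneg r] with t ht
      refine propext ?_
      change n ≤ ⌊t / δ⌋₊ ↔ n * δ ≤ t
      rw [Nat.le_floor_iff (by positivity), le_div_iff₀ hδ]
    rw [Measure.real, Measure.map_apply hm measurableSet_Ici, measure_congr e,
      expLaw_Ici hr (by positivity), ENNReal.toReal_ofReal (by positivity), ← Real.exp_nat_mul]
    congr 1
    ring
  have hd : ({n} : Set ℕ) = Ici n \ Ici (n + 1) := by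
    ext k
    simp
    lia
  have := Measure.isProbabilityMeasure_map (μ := expLaw r) hm.aemeasurable
  rw [hd, measureReal_sdiff (Ici_subset_Ici.2 n.le_succ) measurableSet_Ici, hI, hI, pow_succ]
  ring

/-- The integer part of an exponential variable is geometric. -/
lemma integral_gridIdx {r : ℝ} (hr : 0 < r) {δ : ℝ} (hδ : 0 < δ) {a : ℕ → ℂ}
    (ha : ∀ n, ‖a n‖ ≤ 1) :
    (1 - Real.exp (-r * δ)) * ∑' n : ℕ, (Real.exp (-r * δ) : ℂ) ^ n * a n
      = (1 - Real.exp (-r * δ)) * a 0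
        + Real.exp (-r * δ) * ∫ t, a (gridIdx δ t) ∂expLaw r := by
  have := isProbabilityMeasure_expLaw hr
  set q := Real.exp (-r * δ) with hq
  have hq0 : 0 ≤ q := by positivity
  have hq1 : q < 1 := by
    rw [hq, Real.exp_lt_one_iff]
    nlinarith
  have hm : Measurable fun t : ℝ => ⌊t / δ⌋₊ := Nat.measurable_floor.comp (by fun_prop)
  have := Measure.isProbabilityMeasure_map (μ := expLaw r) hm.aemeasurable
  have hi : ∫ t, a (gridIdx δ t) ∂expLaw r = ∑' n : ℕ, ((1 - q) * q ^ n : ℂ) * a (n + 1) := by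
    change ∫ t, a (⌊t / δ⌋₊ + 1) ∂expLaw r = _
    rw [← integral_map (φ := fun t : ℝ => ⌊t / δ⌋₊) (f := fun n => a (n + 1)) hm.aemeasurable
      Measurable.of_discrete.aestronglyMeasurable, integral_countable
      (.of_bound Measurable.of_discrete.aestronglyMeasurable 1 (.of_forall fun n => ha _))]
    refine tsum_congr fun n => ?_
    rw [expLaw_floor_real hr hδ, Complex.real_smul, ← hq]
    push_cast
    rfl
  have hs : Summable fun n : ℕ => (q : ℂ) ^ n * a n := by
    refine Summable.of_norm_bounded (summable_geometric_of_lt_one hq0 hq1) fun n => ?_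
    rw [norm_mul, norm_pow, Complex.norm_real, Real.norm_of_nonneg hq0]
    exact mul_le_of_le_one_right (by positivity) (ha n)
  rw [hs.tsum_eq_zero_add, hi, ← tsum_mul_left, mul_add, ← tsum_mul_left]
  congr 1
  · simp
  · refine tsum_congr fun n => ?_
    ring

/-- A Lévy process relative to a filtration. -/
structure IsLevy {Ω : Type*} {m : MeasurableSpace Ω} (P : Measure Ω) (X : ℝ → Ω → ℝ)
    (F : Filtration ℝ m) : Prop where
  meas : Measurable (Function.uncurry X)
  adapted : ∀ t, Measurable[F t] (X t)
  zero : ∀ᵐ ω ∂P, X 0 ω = 0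
  cadlag : ∀ ω, IsCadlag (fun s => X s ω)
  stat : ∀ s t : ℝ, 0 ≤ s → s ≤ t → P.map (fun ω => X t ω - X s ω) = P.map (X (t - s))
  indep : ∀ s t : ℝ, 0 ≤ s → s ≤ t →
    Indep (MeasurableSpace.comap (fun ω => X t ω - X s ω) inferInstance) (F s) P

/-- `L f s t` is the limit, as the mesh tends to zero, of the functional `Φ` of the increments of
`f` along a grid of `[s, t]`. -/
structure IsGridLimit (Φ : (ℕ → ℝ) → ℕ → ℝ) (L : (ℝ → ℝ) → ℝ → ℝ → ℝ) : Prop where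
  meas : ∀ k, Measurable fun d => Φ d k
  zero : ∀ d, Φ d 0 = 0
  lim : ∀ {f : ℝ → ℝ}, IsCadlag f → ∀ {s t : ℝ}, s ≤ t →
    Tendsto (fun n => Φ (gridStep f s (mesh n)) (gridIdx (mesh n) (t - s))) atTop (𝓝 (L f s t))

lemma isGridLimit_sum : IsGridLimit stepSum fun f s t => f t - f s :=
  ⟨measurable_stepSum, stepSum_zero, fun hf _ _ h => hf.tendsto_stepSum_gridStep h⟩

lemma isGridLimit_max : IsGridLimit stepMax fun f s t => supIcc f s t - f s :=
  ⟨measurable_stepMax, fun d => by simp [stepMax, stepSum_zero],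
    fun hf _ _ h => hf.tendsto_stepMax_gridStep h⟩

lemma isGridLimit_min : IsGridLimit stepMin fun f s t => sInf (f '' Icc s t) - f s :=
  ⟨measurable_stepMin, fun d => by simp [stepMin, stepMax, stepSum_zero],
    fun hf _ _ h => hf.tendsto_stepMin_gridStep h⟩

namespace IsLevy

variable {Ω : Type*} {m : MeasurableSpace Ω} {P : Measure Ω}
  {X : ℝ → Ω → ℝ} {F : Filtration ℝ m}

lemma measurable (h : IsLevy P X F) (t : ℝ) : Measurable (X t) :=
  (h.adapted t).mono (F.le t) le_rfl

lemma isIIDStep (h : IsLevy P X F) {s δ : ℝ} (hs : 0 ≤ s) (hδ : 0 < δ) :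
    IsIIDStep P (fun j => F (s + j * δ)) (fun j ω => gridStep (fun u => X u ω) s δ j)
      (P.map (X δ)) where
  le k := F.le _
  mono i j hij := F.mono (by gcongr)
  meas k := (h.adapted _).sub ((h.adapted _).mono (F.mono (by gcongr; simp)) le_rfl)
  law k := by
    have := h.stat (s + k * δ) (s + (k + 1 : ℕ) * δ) (by positivity) (by gcongr; simp)
    rw [show s + (k + 1 : ℕ) * δ - (s + k * δ) = δ by push_cast; ring] at this
    exact this
  indep k := h.indep _ _ (by positivity) (by gcongr; simp)

lemma measurable_gridIdx (δ : ℝ) : Measurable (gridIdx δ) :=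
  (Nat.measurable_floor.comp (measurable_id.div_const δ)).add_const 1

lemma measurable_gridStep (h : IsLevy P X F) (s δ : ℝ) :
    Measurable fun ω => gridStep (fun u => X u ω) s δ :=
  measurable_pi_lambda _ fun _ => (h.measurable _).sub (h.measurable _)

variable {Φ : (ℕ → ℝ) → ℕ → ℝ} {L : (ℝ → ℝ) → ℝ → ℝ → ℝ}

lemma measurable_gridFunctional (h : IsLevy P X F) (hL : IsGridLimit Φ L) (s δ : ℝ) :
    Measurable fun z : ℝ × Ω => Φ (gridStep (fun u => X u z.2) s δ) (gridIdx δ (z.1 - s)) := by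
  have h1 : Measurable fun z : ℕ × Ω => Φ (gridStep (fun u => X u z.2) s δ) z.1 :=
    measurable_from_prod_countable_right fun k => (hL.meas k).comp (h.measurable_gridStep s δ)
  exact h1.comp (((measurable_gridIdx δ).comp (measurable_fst.sub_const s)).prodMk
    measurable_snd)

lemma aemeasurable_functional (h : IsLevy P X F) (hL : IsGridLimit Φ L) (s : ℝ)
    (μ : Measure (ℝ × Ω)) (hμ : ∀ᵐ z ∂μ, s ≤ z.1) :
    AEMeasurable (fun z : ℝ × Ω => L (fun u => X u z.2) s z.1) μ := by
  refine aemeasurable_of_tendsto_metrizable_ae atTop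
    (fun n => (h.measurable_gridFunctional hL s (mesh n)).aemeasurable) ?_
  filter_upwards [hμ] with z hz
  exact hL.lim (h.cadlag _) hz

lemma norm_exp_mul_I (a b : ℝ) : ‖Complex.exp (a * b * Complex.I)‖ = 1 := by
  rw [← Complex.ofReal_mul, Complex.norm_exp_ofReal_mul_I]

lemma measurable_exp_mul_I {α : Type*} {mα : MeasurableSpace α} {Y : α → ℝ} (hY : Measurable Y)
    (θ : ℝ) : Measurable fun a => Complex.exp (θ * Y a * Complex.I) := by
  fun_prop

variable [IsProbabilityMeasure P]

lemma tendsto_integral_exp (h : IsLevy P X F) (hL : IsGridLimit Φ L) {s t : ℝ} (hst : s ≤ t)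
    {f : Ω → ℂ} (hf : Measurable f) (hf1 : ∀ ω, ‖f ω‖ ≤ 1) (θ : ℝ) :
    Tendsto (fun n => ∫ ω, f ω * Complex.exp (θ * Φ (gridStep (fun u => X u ω) s (mesh n))
      (gridIdx (mesh n) (t - s)) * Complex.I) ∂P) atTop
      (𝓝 (∫ ω, f ω * Complex.exp (θ * L (fun u => X u ω) s t * Complex.I) ∂P)) := by
  refine tendsto_integral_of_dominated_convergence (fun _ => 1) (fun n => ?_)
    (integrable_const _) (fun n => .of_forall fun ω => ?_) (.of_forall fun ω => ?_)
  · have := (hL.meas (gridIdx (mesh n) (t - s))).comp (h.measurable_gridStep s (mesh n))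
    exact (hf.mul (measurable_exp_mul_I this θ)).aestronglyMeasurable
  · rw [norm_mul, norm_exp_mul_I, mul_one]
    exact hf1 ω
  · have h1 := (Complex.continuous_ofReal.tendsto _).comp (hL.lim (h.cadlag ω) hst)
    exact (((h1.const_mul (θ : ℂ)).mul_const Complex.I).cexp).const_mul (f ω)

/-- Independence and stationarity of the increments, for path functionals. -/
lemma integral_mul_exp_functional (h : IsLevy P X F) (hL : IsGridLimit Φ L) {s t : ℝ}
    (hs : 0 ≤ s) (ht : 0 ≤ t) {f : Ω → ℂ} (hf : Measurable[F s] f) (hf1 : ∀ ω, ‖f ω‖ ≤ 1)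
    (θ : ℝ) :
    ∫ ω, f ω * Complex.exp (θ * L (fun u => X u ω) s (s + t) * Complex.I) ∂P
      = (∫ ω, f ω ∂P)
        * ∫ ω, Complex.exp (θ * L (fun u => X u ω) 0 t * Complex.I) ∂P := by
  have h1 := h.tendsto_integral_exp hL (le_add_of_nonneg_right ht : s ≤ s + t)
    (hf.mono (F.le s) le_rfl) hf1 θ
  have h2 := (h.tendsto_integral_exp hL ht (measurable_const (a := (1 : ℂ))) (by simp) θ).const_mul
    (∫ ω, f ω ∂P)
  simp only [one_mul, add_sub_cancel_left, sub_zero] at h1 h2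
  refine tendsto_nhds_unique h1 (h2.congr fun n => ?_)
  have hΨ : Measurable fun d : ℕ → ℝ =>
      Complex.exp (θ * Φ d (gridIdx (mesh n) t) * Complex.I) :=
    measurable_exp_mul_I (hL.meas _) θ
  have hf' : Measurable[F (s + (0 : ℕ) * mesh n)] f := by
    have e : s + (0 : ℕ) * mesh n = s := by simp
    rwa [e]
  have h3 := (h.isIIDStep hs (mesh_pos n)).integral_mul hf' hΨ
  have h4 := (h.isIIDStep hs (mesh_pos n)).integral_path_eq
    (h.isIIDStep le_rfl (mesh_pos n)) hΨ
  rw [h4] at h3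
  exact h3.symm

end IsLevy

/-- The law of the path functional `L` over `[0, T]`, where `T` is exponential and independent of
the process. -/
def expTimeLaw {Ω : Type*} [MeasurableSpace Ω] (P : Measure Ω) (X : ℝ → Ω → ℝ) (r : ℝ)
    (L : (ℝ → ℝ) → ℝ → ℝ → ℝ) : Measure ℝ :=
  ((expLaw r).prod P).map fun z => L (fun u => X u z.2) 0 z.1

namespace IsLevy

variable {Ω : Type*} {m : MeasurableSpace Ω} {P : Measure Ω}
  {X : ℝ → Ω → ℝ} {F : Filtration ℝ m}
  {Φ : (ℕ → ℝ) → ℕ → ℝ} {L : (ℝ → ℝ) → ℝ → ℝ → ℝ} {r : ℝ}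

lemma ae_prod_nonneg (hr : 0 < r) : ∀ᵐ z ∂(expLaw r).prod P, 0 ≤ z.1 := by
  have := isProbabilityMeasure_expLaw hr
  exact Measure.quasiMeasurePreserving_fst.ae (ae_expLaw_nonneg r)

variable [IsProbabilityMeasure P]

lemma isProbabilityMeasure_expTimeLaw (h : IsLevy P X F) (hL : IsGridLimit Φ L) (hr : 0 < r) :
    IsProbabilityMeasure (expTimeLaw P X r L) := by
  have := isProbabilityMeasure_expLaw hr
  exact Measure.isProbabilityMeasure_map (h.aemeasurable_functional hL 0 _ (ae_prod_nonneg hr))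

lemma charFun_expTimeLaw (h : IsLevy P X F) (hL : IsGridLimit Φ L) (hr : 0 < r) (θ : ℝ) :
    charFun (expTimeLaw P X r L) θ
      = ∫ t, ∫ ω, Complex.exp (θ * L (fun u => X u ω) 0 t * Complex.I) ∂P ∂expLaw r := by
  have := isProbabilityMeasure_expLaw hr
  have hm := h.aemeasurable_functional hL 0 _ (ae_prod_nonneg (P := P) hr)
  rw [charFun_apply_real, expTimeLaw, integral_map hm
    (measurable_exp_mul_I measurable_id' θ).aestronglyMeasurable, integral_prod]
  refine Integrable.of_bound ((measurable_exp_mul_I measurable_id' θ).comp_aemeasurable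
    hm).aestronglyMeasurable 1 (.of_forall fun z => ?_)
  rw [norm_exp_mul_I]

/-- The law of a path functional of the post-`s` process, evaluated at the exponential time. -/
lemma map_restrict_add_functional (h : IsLevy P X F) (hL : IsGridLimit Φ L) (hr : 0 < r) {s : ℝ}
    (hs : 0 ≤ s) {A : Set Ω} (hA : MeasurableSet[F s] A) :
    (((expLaw r).prod P).restrict (Ici s ×ˢ A)).map
        (fun z => X s z.2 + L (fun u => X u z.2) s z.1)
      = (ENNReal.ofReal (Real.exp (-r * s)) • (P.restrict A).map (X s)) ∗ expTimeLaw P X r L := by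
  have := isProbabilityMeasure_expLaw hr
  have := h.isProbabilityMeasure_expTimeLaw hL hr
  have hA' := F.le s _ hA
  have hmem : ∀ᵐ z ∂((expLaw r).prod P).restrict (Ici s ×ˢ A), s ≤ z.1 := by
    filter_upwards [ae_restrict_mem (measurableSet_Ici.prod hA')] with z hz using hz.1
  have hm : AEMeasurable (fun z : ℝ × Ω => X s z.2 + L (fun u => X u z.2) s z.1)
      (((expLaw r).prod P).restrict (Ici s ×ˢ A)) :=
    ((h.measurable s).comp measurable_snd).aemeasurable.add (h.aemeasurable_functional hL s _ hmem)
  have : IsFiniteMeasure (ENNReal.ofReal (Real.exp (-r * s)) • (P.restrict A).map (X s)) :=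
    Measure.smul_finite _ ENNReal.ofReal_ne_top
  refine Measure.ext_of_charFun (funext fun θ => ?_)
  have hf : Measurable[F s] (A.indicator fun ω => Complex.exp (θ * X s ω * Complex.I)) :=
    Measurable.indicator (measurable_exp_mul_I (h.adapted s) θ) hA
  have hf1 : ∀ ω, ‖A.indicator (fun ω => Complex.exp (θ * X s ω * Complex.I)) ω‖ ≤ 1 := fun ω => by
    by_cases hω : ω ∈ A
    · rw [indicator_of_mem hω, norm_exp_mul_I]
    · simp [hω]
  rw [charFun_conv, h.charFun_expTimeLaw hL hr, charFun_apply_real, charFun_apply_real,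
    integral_smul_measure, integral_map hm
    (measurable_exp_mul_I measurable_id' θ).aestronglyMeasurable, setIntegral_prod,
    setIntegral_Ici_expLaw hr hs, integral_map (h.measurable s).aemeasurable
    (measurable_exp_mul_I measurable_id' θ).aestronglyMeasurable,
    ENNReal.toReal_ofReal (by positivity), smul_mul_assoc, ← integral_const_mul]
  · congr 1
    refine integral_congr_ae ?_
    filter_upwards [ae_expLaw_nonneg r] with t ht
    rw [← integral_indicator hA', ← integral_indicator hA',
      ← h.integral_mul_exp_functional hL hs ht hf hf1 θ]
    refine integral_congr_ae (.of_forall fun ω => ?_)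
    by_cases hω : ω ∈ A
    · simp only [indicator_of_mem hω]
      rw [← Complex.exp_add]
      congr 1
      push_cast
      ring
    · simp [hω]
  · refine Integrable.of_bound ((measurable_exp_mul_I measurable_id' θ).comp_aemeasurable
      hm).aestronglyMeasurable 1 (.of_forall fun z => ?_)
    rw [norm_exp_mul_I]

lemma tendsto_geometric_charFun (h : IsLevy P X F) (hL : IsGridLimit Φ L) (hr : 0 < r) (θ : ℝ) :
    Tendsto (fun n => (1 - Real.exp (-r * mesh n)) * ∑' k : ℕ, (Real.exp (-r * mesh n) : ℂ) ^ k
      * ∫ ω, Complex.exp (θ * Φ (gridStep (fun u => X u ω) 0 (mesh n)) k * Complex.I) ∂P) atTop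
      (𝓝 (charFun (expTimeLaw P X r L) θ)) := by
  have := isProbabilityMeasure_expLaw hr
  have ha : ∀ n k, ‖∫ ω, Complex.exp (θ * Φ (gridStep (fun u => X u ω) 0 (mesh n)) k
      * Complex.I) ∂P‖ ≤ 1 := fun n k =>
    (norm_integral_le_of_norm_le_const (C := 1) (.of_forall fun ω =>
      (norm_exp_mul_I _ _).le)).trans (by simp)
  have hq : Tendsto (fun n => (Real.exp (-r * mesh n) : ℂ)) atTop (𝓝 1) := by
    have h1 : Tendsto (fun n => Real.exp (-r * mesh n)) atTop (𝓝 1) := by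
      simpa using ((tendsto_mesh.const_mul (-r)).rexp)
    exact_mod_cast (Complex.continuous_ofReal.tendsto _).comp h1
  have hI : Tendsto (fun n => ∫ t, ∫ ω, Complex.exp (θ * Φ (gridStep (fun u => X u ω) 0 (mesh n))
      (gridIdx (mesh n) t) * Complex.I) ∂P ∂expLaw r) atTop
      (𝓝 (charFun (expTimeLaw P X r L) θ)) := by
    rw [h.charFun_expTimeLaw hL hr]
    refine tendsto_integral_of_dominated_convergence (fun _ => 1) (fun n => ?_)
      (integrable_const _) (fun n => .of_forall fun t => ha _ _) ?_
    · exact (Measurable.of_discrete (f := fun k : ℕ => ∫ ω, Complex.exp (θ *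
        Φ (gridStep (fun u => X u ω) 0 (mesh n)) k * Complex.I) ∂P)).comp
        (measurable_gridIdx (mesh n)) |>.aestronglyMeasurable
    · filter_upwards [ae_expLaw_nonneg r] with t ht
      simpa using h.tendsto_integral_exp hL ht (measurable_const (a := (1 : ℂ))) (by simp) θ
  have hlim := ((tendsto_const_nhds (x := (1 : ℂ))).sub hq).add (hq.mul hI)
  rw [sub_self, zero_add, one_mul] at hlim
  refine hlim.congr fun n => ?_
  rw [integral_gridIdx hr (mesh_pos n) (ha n)]
  simp [hL.zero]

/-- Wiener–Hopf factorization at an independent exponential time. -/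
lemma expTimeLaw_sum_eq_conv (h : IsLevy P X F) (hr : 0 < r) :
    expTimeLaw P X r (fun f s t => f t - f s)
      = expTimeLaw P X r (fun f s t => supIcc f s t - f s)
        ∗ expTimeLaw P X r (fun f s t => sInf (f '' Icc s t) - f s) := by
  have := h.isProbabilityMeasure_expTimeLaw isGridLimit_sum hr
  have := h.isProbabilityMeasure_expTimeLaw isGridLimit_max hr
  have := h.isProbabilityMeasure_expTimeLaw isGridLimit_min hr
  refine Measure.ext_of_charFun (funext fun θ => ?_)
  rw [charFun_conv]
  refine tendsto_nhds_unique (h.tendsto_geometric_charFun isGridLimit_sum hr θ)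
    (((h.tendsto_geometric_charFun isGridLimit_max hr θ).mul
      (h.tendsto_geometric_charFun isGridLimit_min hr θ)).congr fun n => ?_)
  exact ((h.isIIDStep le_rfl (mesh_pos n)).wienerHopf (by positivity)
    (by rw [Real.exp_lt_one_iff]; nlinarith [mesh_pos n]) θ).symm

end IsLevy

/-- The part of `ℝ × Ω` on or after the grid time `k δ`. -/
def stopRegion {Ω : Type*} (δ : ℝ) (k : Ω → ℕ∞) : Set (ℝ × Ω) :=
  ⋃ j : ℕ, Ici (j * δ) ×ˢ {ω | k ω = j}

/-- The supremum of the process over `[k δ, t]`. -/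
def postMax {Ω : Type*} (X : ℝ → Ω → ℝ) (δ : ℝ) (k : Ω → ℕ∞) (z : ℝ × Ω) : ℝ :=
  supIcc (fun u => X u z.2) ((k z.2).toNat * δ) z.1

/-- Grid-valued stopping indices. -/
def IsGridStop {Ω : Type*} {m : MeasurableSpace Ω} (F : Filtration ℝ m) (δ : ℝ) (k : Ω → ℕ∞) :
    Prop :=
  ∀ j : ℕ, MeasurableSet[F (j * δ)] {ω | k ω = j}

/-- The law of the running infimum at an independent exponential time. -/
abbrev infLaw {Ω : Type*} [MeasurableSpace Ω] (P : Measure Ω) (X : ℝ → Ω → ℝ) (r : ℝ) :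
    Measure ℝ :=
  expTimeLaw P X r fun f s t => sInf (f '' Icc s t) - f s

/-- Running payoff up to `τ`, in excess of the stopping cost `c`. -/
def runPayoff {Ω : Type*} [MeasurableSpace Ω] (P : Measure Ω) (X : ℝ → Ω → ℝ) (r : ℝ)
    (ψ : ℝ → ℝ) (c : ℝ) (τ : Ω → ℝ≥0∞) : ℝ :=
  c + ∫ z in {z : ℝ × Ω | ENNReal.ofReal z.1 < τ z.2}, (ψ (X z.1 z.2) - c) ∂(expLaw r).prod P

/-- The grid time with index `k`. -/
def gridTime {Ω : Type*} (δ : ℝ) (k : Ω → ℕ∞) (ω : Ω) : ℝ≥0∞ :=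
  (k ω : ℝ≥0∞) * ENNReal.ofReal δ

lemma Measure.sum_conv {ι : Type*} (μ : ι → Measure ℝ) (ν : Measure ℝ) [SFinite ν] :
    (Measure.sum μ) ∗ ν = Measure.sum fun i => μ i ∗ ν := by
  unfold Measure.conv
  rw [Measure.prod_sum_left, Measure.map_sum (by fun_prop)]

lemma gridTime_le_iff {Ω : Type*} {δ : ℝ} (hδ : 0 < δ) (k : Ω → ℕ∞) {z : ℝ × Ω} (hz : 0 ≤ z.1) :
    gridTime δ k z.2 ≤ ENNReal.ofReal z.1 ↔ z ∈ stopRegion δ k := by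
  simp only [stopRegion, mem_iUnion, mem_prod, mem_Ici, Set.mem_ofPred_eq, gridTime]
  cases hk : k z.2 with
  | top => simp [ENNReal.top_mul, hδ]
  | coe j =>
    have : ((j : ℕ∞) : ℝ≥0∞) * ENNReal.ofReal δ = ENNReal.ofReal (j * δ) := by
      rw [ENNReal.ofReal_mul (by positivity)]
      simp
    rw [this, ENNReal.ofReal_le_ofReal_iff hz]
    simp

namespace IsLevy

variable {Ω : Type*} {m : MeasurableSpace Ω} {P : Measure Ω}
  {X : ℝ → Ω → ℝ} {F : Filtration ℝ m} {r : ℝ} {δ : ℝ} {k : Ω → ℕ∞}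

lemma measurableSet_stopRegion (hk : IsGridStop F δ k) : MeasurableSet (stopRegion δ k) :=
  .iUnion fun j => measurableSet_Ici.prod (F.le _ _ (hk j))

lemma pairwise_disjoint_stopRegion (δ : ℝ) (k : Ω → ℕ∞) : Pairwise (Function.onFun Disjoint
    fun j : ℕ => Ici ((j : ℝ) * δ) ×ˢ {ω | k ω = j}) := fun i j hij => by
  refine Set.disjoint_left.2 fun z hi hj => hij ?_
  have h1 : k z.2 = i := hi.2
  have h2 : k z.2 = j := hj.2
  exact_mod_cast h1.symm.trans h2

lemma aemeasurable_supIcc (h : IsLevy P X F) (s : ℝ) (μ : Measure (ℝ × Ω))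
    (hμ : ∀ᵐ z ∂μ, s ≤ z.1) : AEMeasurable (fun z : ℝ × Ω => supIcc (fun u => X u z.2) s z.1) μ :=
  ((h.aemeasurable_functional isGridLimit_max s μ hμ).add
    ((h.measurable s).comp measurable_snd).aemeasurable).congr (.of_forall fun z => by simp)

lemma postMax_ae_eq (hk : IsGridStop F δ k) (j : ℕ) :
    postMax X δ k =ᵐ[((expLaw r).prod P).restrict (Ici (j * δ) ×ˢ {ω | k ω = j})]
      fun z => supIcc (fun u => X u z.2) (j * δ) z.1 := by
  filter_upwards [ae_restrict_mem (measurableSet_Ici.prod (F.le _ _ (hk j)))] with z hz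
  have : k z.2 = j := hz.2
  simp [postMax, this]

lemma stopRegion_zero_ae_eq (hr : 0 < r) (δ : ℝ) :
    stopRegion δ (fun _ : Ω => 0) =ᵐ[(expLaw r).prod P] univ := by
  filter_upwards [ae_prod_nonneg (P := P) hr] with z hz
  refine propext ⟨fun _ => trivial, fun _ => mem_iUnion.2 ⟨0, ?_⟩⟩
  simpa using hz

lemma aemeasurable_postMax (h : IsLevy P X F) (hk : IsGridStop F δ k) :
    AEMeasurable (postMax X δ k) (((expLaw r).prod P).restrict (stopRegion δ k)) := by
  refine aemeasurable_iUnion_iff.2 fun j => ?_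
  refine (h.aemeasurable_supIcc (j * δ) _ ?_).congr (postMax_ae_eq hk j).symm
  filter_upwards [ae_restrict_mem (measurableSet_Ici.prod (F.le _ _ (hk j)))] with z hz using hz.1

variable [IsProbabilityMeasure P]

lemma map_restrict_rectangle (h : IsLevy P X F) (hr : 0 < r) {s : ℝ}
    (hs : 0 ≤ s) {A : Set Ω} (hA : MeasurableSet[F s] A) :
    (((expLaw r).prod P).restrict (Ici s ×ˢ A)).map (fun z => X z.1 z.2)
      = ((((expLaw r).prod P).restrict (Ici s ×ˢ A)).map
          (fun z => supIcc (fun u => X u z.2) s z.1)) ∗ infLaw P X r := by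
  have := h.isProbabilityMeasure_expTimeLaw isGridLimit_max hr
  have := h.isProbabilityMeasure_expTimeLaw isGridLimit_min hr
  have : IsFiniteMeasure (ENNReal.ofReal (Real.exp (-r * s)) • (P.restrict A).map (X s)) :=
    Measure.smul_finite _ ENNReal.ofReal_ne_top
  have h1 := h.map_restrict_add_functional isGridLimit_sum hr hs hA
  have h2 := h.map_restrict_add_functional isGridLimit_max hr hs hA
  simp only [add_sub_cancel] at h1 h2
  rw [h1, h2, h.expTimeLaw_sum_eq_conv hr, Measure.conv_assoc]

/-- Wiener–Hopf factorization after a grid stopping time. -/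
lemma map_restrict_stopRegion (h : IsLevy P X F) (hr : 0 < r) (hδ : 0 < δ)
    (hk : IsGridStop F δ k) :
    (((expLaw r).prod P).restrict (stopRegion δ k)).map (fun z => X z.1 z.2)
      = ((((expLaw r).prod P).restrict (stopRegion δ k)).map (postMax X δ k))
        ∗ infLaw P X r := by
  have := h.isProbabilityMeasure_expTimeLaw isGridLimit_min hr
  have hp := h.aemeasurable_postMax (r := r) hk
  have hX : Measurable fun z : ℝ × Ω => X z.1 z.2 := h.meas
  have hE : ((expLaw r).prod P).restrict (stopRegion δ k) = Measure.sum fun j : ℕ =>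
      ((expLaw r).prod P).restrict (Ici (j * δ) ×ˢ {ω | k ω = j}) :=
    Measure.restrict_iUnion (pairwise_disjoint_stopRegion δ k) fun j =>
      measurableSet_Ici.prod (F.le _ _ (hk j))
  rw [hE] at hp ⊢
  rw [Measure.map_sum hX.aemeasurable, Measure.map_sum hp, Measure.sum_conv]
  congr 1
  ext1 j
  rw [h.map_restrict_rectangle hr (by positivity) (hk j), Measure.map_congr (postMax_ae_eq hk j)]

variable {ψ K : ℝ → ℝ} {c : ℝ}

lemma integrable_and_integral_postMax (h : IsLevy P X F) (hr : 0 < r) (hδ : 0 < δ)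
    (hk : IsGridStop F δ k) (hψ : Measurable ψ)
    (hi : Integrable (fun z => ψ (X z.1 z.2)) ((expLaw r).prod P))
    (hK : ∀ y, K y = ∫ b, ψ (y + b) ∂infLaw P X r) :
    IntegrableOn (fun z => K (postMax X δ k z)) (stopRegion δ k) ((expLaw r).prod P) ∧
      ∫ z in stopRegion δ k, ψ (X z.1 z.2) ∂(expLaw r).prod P
        = ∫ z in stopRegion δ k, K (postMax X δ k z) ∂(expLaw r).prod P := by
  have := isProbabilityMeasure_expLaw hr
  have := h.isProbabilityMeasure_expTimeLaw isGridLimit_min hr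
  have hp := h.aemeasurable_postMax (r := r) hk
  have hX : Measurable fun z : ℝ × Ω => X z.1 z.2 := h.meas
  have hKm : StronglyMeasurable K := by
    have : K = fun y => ∫ b, ψ (y + b) ∂infLaw P X r := funext hK
    rw [this]
    exact StronglyMeasurable.integral_prod_right (f := fun y b => ψ (y + b))
      (hψ.comp (measurable_fst.add measurable_snd)).stronglyMeasurable
  have h1 := h.map_restrict_stopRegion hr hδ hk
  have h2 : Integrable ψ ((((expLaw r).prod P).restrict (stopRegion δ k)).map
      (fun z => X z.1 z.2)) :=
    (integrable_map_measure hψ.aestronglyMeasurable hX.aemeasurable).2 hi.integrableOn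
  have h3 := h2
  rw [h1] at h3
  have h4 : Integrable K ((((expLaw r).prod P).restrict (stopRegion δ k)).map
      (postMax X δ k)) := by
    have h5 := ((integrable_map_measure hψ.aestronglyMeasurable (by fun_prop)).1 h3)
    exact h5.integral_prod_left.congr (.of_forall fun y => (hK y).symm)
  refine ⟨(integrable_map_measure hKm.aestronglyMeasurable hp).1 h4, ?_⟩
  rw [← integral_map hX.aemeasurable hψ.aestronglyMeasurable, h1, integral_conv h3,
    ← integral_map hp hKm.aestronglyMeasurable]
  exact integral_congr_ae (.of_forall fun y => (hK y).symm)

lemma isGridStop_zero (F : Filtration ℝ m) (δ : ℝ) : IsGridStop F δ (fun _ : Ω => 0) := fun j => by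
  by_cases hj : (0 : ℕ∞) = j <;> simp [hj]

lemma integrable_and_integral_sup (h : IsLevy P X F) (hr : 0 < r) (hψ : Measurable ψ)
    (hi : Integrable (fun z => ψ (X z.1 z.2)) ((expLaw r).prod P))
    (hK : ∀ y, K y = ∫ b, ψ (y + b) ∂infLaw P X r) :
    Integrable (fun z => K (supIcc (fun u => X u z.2) 0 z.1)) ((expLaw r).prod P) ∧
      ∫ z, ψ (X z.1 z.2) ∂(expLaw r).prod P
        = ∫ z, K (supIcc (fun u => X u z.2) 0 z.1) ∂(expLaw r).prod P := by
  have h1 := h.integrable_and_integral_postMax hr one_pos (isGridStop_zero F 1) hψ hi hK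
  simpa [IntegrableOn, Measure.restrict_congr_set (stopRegion_zero_ae_eq hr 1), postMax] using h1

/-- The value of the stopping problem. -/
def _root_.gittinsValue (P : Measure Ω) (X : ℝ → Ω → ℝ) (r : ℝ) (K : ℝ → ℝ) (c : ℝ) : ℝ :=
  c - ∫ z, max (c - K (supIcc (fun u => X u z.2) 0 z.1)) 0 ∂(expLaw r).prod P

lemma runPayoff_gridTime_sub_value (h : IsLevy P X F) (hr : 0 < r) (hδ : 0 < δ)
    (hk : IsGridStop F δ k) (hψ : Measurable ψ)
    (hi : Integrable (fun z => ψ (X z.1 z.2)) ((expLaw r).prod P))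
    (hK : ∀ y, K y = ∫ b, ψ (y + b) ∂infLaw P X r) (c : ℝ) :
    runPayoff P X r ψ c (gridTime δ k) - gittinsValue P X r K c
      = ∫ z, max (K (supIcc (fun u => X u z.2) 0 z.1) - c) 0 ∂(expLaw r).prod P
        - ∫ z in stopRegion δ k, (K (postMax X δ k z) - c) ∂(expLaw r).prod P := by
  have := isProbabilityMeasure_expLaw hr
  obtain ⟨h1, h2⟩ := h.integrable_and_integral_sup hr hψ hi hK
  obtain ⟨h3, h4⟩ := h.integrable_and_integral_postMax hr hδ hk hψ hi hK
  have hE : {z : ℝ × Ω | ENNReal.ofReal z.1 < gridTime δ k z.2}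
      =ᵐ[(expLaw r).prod P] ((stopRegion δ k)ᶜ : Set (ℝ × Ω)) := by
    filter_upwards [ae_prod_nonneg (P := P) hr] with z hz
    refine propext ?_
    change ENNReal.ofReal z.1 < gridTime δ k z.2 ↔ z ∉ stopRegion δ k
    rw [← gridTime_le_iff hδ k hz, not_le]
  have hic : Integrable (fun z => ψ (X z.1 z.2) - c) ((expLaw r).prod P) :=
    hi.sub (integrable_const c)
  have h5 := integral_add_compl (measurableSet_stopRegion hk) hic
  rw [integral_sub hi (integrable_const c), h2, integral_sub hi.integrableOn (integrable_const c),
    h4, ← integral_sub h1 (integrable_const c), ← integral_sub h3 (integrable_const c)] at h5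
  have h6 : ∫ z, (K (supIcc (fun u => X u z.2) 0 z.1) - c) ∂(expLaw r).prod P
      = ∫ z, max (K (supIcc (fun u => X u z.2) 0 z.1) - c) 0 ∂(expLaw r).prod P
        - ∫ z, max (c - K (supIcc (fun u => X u z.2) 0 z.1)) 0 ∂(expLaw r).prod P := by
    rw [← integral_sub]
    · refine integral_congr_ae (.of_forall fun z => ?_)
      simp only
      rcases le_total (K (supIcc (fun u => X u z.2) 0 z.1)) c with hle | hle
      · rw [max_eq_right (by linarith), max_eq_left (by linarith)]
        ring
      · rw [max_eq_left (by linarith), max_eq_right (by linarith)]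
        ring
    · exact (h1.sub (integrable_const c)).pos_part
    · exact ((integrable_const c).sub h1).pos_part
  rw [runPayoff, gittinsValue, setIntegral_congr_set hE]
  rw [h6, ← eq_sub_iff_add_eq'] at h5
  rw [h5]
  ring

end IsLevy

/-- Optional times: stopping times of the right-continuous augmentation of the filtration. -/
def IsOptional {Ω : Type*} {m : MeasurableSpace Ω} (F : Filtration ℝ m) (σ : Ω → ℝ≥0∞) : Prop :=
  ∀ t : ℝ, MeasurableSet[F t] {ω | σ ω < ENNReal.ofReal t}

/-- A strict bound by `t > 0` already holds at `t - 1 / (n + 1)` for some `n`. -/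
lemma lt_ofReal_iff_exists_mesh {a : ℝ≥0∞} {t : ℝ} (ht : 0 < t) :
    a < ENNReal.ofReal t ↔ ∃ n, a ≤ ENNReal.ofReal (t - mesh n) := by
  refine ⟨fun h => ?_, fun ⟨n, hn⟩ => hn.trans_lt
    ((ENNReal.ofReal_lt_ofReal_iff ht).2 (by linarith [mesh_pos n]))⟩
  have h1 : Tendsto (fun n => ENNReal.ofReal (t - mesh n)) atTop (𝓝 (ENNReal.ofReal t)) :=
    ENNReal.tendsto_ofReal (by simpa using tendsto_mesh.const_sub t)
  obtain ⟨n, hn⟩ := (h1.eventually_const_lt h).exists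
  exact ⟨n, hn.le⟩

lemma IsStopTimeE.isOptional {Ω : Type*} {m : MeasurableSpace Ω} {F : Filtration ℝ m}
    {τ : Ω → ℝ≥0∞} (h : IsStopTimeE F τ) : IsOptional F τ := fun t => by
  rcases le_or_gt t 0 with ht | ht
  · simp [ENNReal.ofReal_of_nonpos ht]
  · simp only [lt_ofReal_iff_exists_mesh ht, Set.ofPred_exists]
    exact .iUnion fun n => F.mono (by linarith [mesh_pos n]) _ (h _)

/-- The index of the first grid point strictly after `σ`. -/
def ceilIdx {Ω : Type*} (σ : Ω → ℝ≥0∞) (δ : ℝ) (ω : Ω) : ℕ∞ :=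
  if σ ω = ⊤ then ⊤ else gridIdx δ (σ ω).toReal

lemma gridTime_of_eq {Ω : Type*} {δ : ℝ} {k : Ω → ℕ∞} {ω : Ω} {j : ℕ} (h : k ω = j) :
    gridTime δ k ω = ENNReal.ofReal (j * δ) := by
  rw [gridTime, h, ENNReal.ofReal_mul (by positivity)]
  simp

lemma gridTime_of_eq_top {Ω : Type*} {δ : ℝ} (hδ : 0 < δ) {k : Ω → ℕ∞} {ω : Ω} (h : k ω = ⊤) :
    gridTime δ k ω = ⊤ := by
  simp [gridTime, h, ENNReal.top_mul, hδ]

lemma tendsto_gridTime_ceilIdx {Ω : Type*} (σ : Ω → ℝ≥0∞) (ω : Ω) :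
    Tendsto (fun n => gridTime (mesh n) (ceilIdx σ (mesh n)) ω) atTop (𝓝 (σ ω)) := by
  by_cases h : σ ω = ⊤
  · refine tendsto_const_nhds.congr fun n => ?_
    rw [gridTime_of_eq_top (mesh_pos n) (by simp [ceilIdx, h]), h]
  · have h1 : ∀ n, gridTime (mesh n) (ceilIdx σ (mesh n)) ω
        = ENNReal.ofReal (gridIdx (mesh n) (σ ω).toReal * mesh n) := fun n =>
      gridTime_of_eq (by simp [ceilIdx, h])
    simp only [h1]
    conv_rhs => rw [← ENNReal.ofReal_toReal h]
    exact ENNReal.tendsto_ofReal ((tendsto_gridIdx_mul ENNReal.toReal_nonneg).mono_right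
      nhdsWithin_le_nhds)

lemma IsOptional.isGridStop {Ω : Type*} {m : MeasurableSpace Ω} {F : Filtration ℝ m}
    {σ : Ω → ℝ≥0∞} (h : IsOptional F σ) {δ : ℝ} (hδ : 0 < δ) :
    IsGridStop F δ (ceilIdx σ δ) := fun j => by
  have h1 : {ω | ceilIdx σ δ ω = j}
      = {ω | σ ω < ENNReal.ofReal (j * δ)} \ {ω | σ ω < ENNReal.ofReal ((j - 1) * δ)} := by
    ext ω
    simp only [Set.mem_ofPred_eq, Set.mem_sdiff, ceilIdx]
    by_cases hσ : σ ω = ⊤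
    · simp [hσ]
    simp only [hσ, if_false, Nat.cast_inj, gridIdx]
    set s := (σ ω).toReal
    have hs : 0 ≤ s := ENNReal.toReal_nonneg
    have hσs : σ ω = ENNReal.ofReal s := (ENNReal.ofReal_toReal hσ).symm
    rw [hσs]
    obtain _ | i := j
    · simp
    · rw [ENNReal.ofReal_lt_ofReal_iff (by positivity), not_lt,
        ENNReal.ofReal_le_ofReal_iff hs, Nat.add_right_cancel_iff,
        Nat.floor_eq_iff (by positivity), le_div_iff₀ hδ, div_lt_iff₀ hδ]
      push_cast
      rw [add_sub_cancel_right, and_comm]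
  rw [h1]
  exact (h _).diff (F.mono (by nlinarith) _ (h _))

lemma IsOptional.measurable {Ω : Type*} {m : MeasurableSpace Ω} {F : Filtration ℝ m}
    {σ : Ω → ℝ≥0∞} (h : IsOptional F σ) : Measurable σ := by
  refine measurable_of_Iio fun a => ?_
  induction a with
  | top =>
    have : σ ⁻¹' Iio ⊤ = ⋃ n : ℕ, {ω | σ ω < ENNReal.ofReal n} := by
      ext ω
      simp only [mem_preimage, mem_Iio, mem_iUnion, Set.mem_ofPred_eq, ENNReal.ofReal_natCast]
      exact ⟨fun hω => ENNReal.exists_nat_gt hω.ne, fun ⟨n, hn⟩ => hn.trans_le le_top⟩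
    rw [this]
    exact .iUnion fun n => F.le _ _ (h n)
  | coe a =>
    have h1 := F.le _ _ (h a)
    rwa [ENNReal.ofReal_coe_nnreal] at h1

lemma IsOptional.iSup {Ω : Type*} {m : MeasurableSpace Ω} {F : Filtration ℝ m}
    {σ : ℕ → Ω → ℝ≥0∞} (h : ∀ i, IsOptional F (σ i)) : IsOptional F (fun ω => ⨆ i, σ i ω) :=
  fun t => by
  rcases le_or_gt t 0 with ht | ht
  · simp [ENNReal.ofReal_of_nonpos ht]
  have h1 : {ω | ⨆ i, σ i ω < ENNReal.ofReal t}
      = ⋃ n, ⋂ i, {ω | σ i ω < ENNReal.ofReal (t - mesh n)} := by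
    ext ω
    simp only [mem_iUnion, mem_iInter, Set.mem_ofPred_eq]
    refine ⟨fun hω => ?_, fun ⟨n, hn⟩ => (lt_ofReal_iff_exists_mesh ht).2
      ⟨n, iSup_le fun i => (hn i).le⟩⟩
    have h2 : Tendsto (fun n => ENNReal.ofReal (t - mesh n)) atTop (𝓝 (ENNReal.ofReal t)) :=
      ENNReal.tendsto_ofReal (by simpa using tendsto_mesh.const_sub t)
    obtain ⟨n, hn⟩ := (h2.eventually_const_lt hω).exists
    exact ⟨n, fun i => (le_iSup (fun i => σ i ω) i).trans_lt hn⟩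
  rw [h1]
  exact .iUnion fun n => .iInter fun i => F.mono (by linarith [mesh_pos n]) _ (h i _)

lemma IsGridStop.isStopTimeE {Ω : Type*} {m : MeasurableSpace Ω} {F : Filtration ℝ m} {δ : ℝ}
    {k : Ω → ℕ∞} (h : IsGridStop F δ k) (hδ : 0 < δ) (hk : ∀ ω, k ω ≠ 0) :
    IsStopTimeE F (gridTime δ k) := fun t => by
  have h1 : {ω | gridTime δ k ω ≤ ENNReal.ofReal t} = ⋃ j : ℕ, ⋃ _ : j * δ ≤ t, {ω | k ω = j} := by
    ext ω
    simp only [mem_iUnion, Set.mem_ofPred_eq, exists_prop]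
    cases hj : k ω with
    | top => simp [gridTime_of_eq_top hδ hj]
    | coe j =>
      have hj0 : 0 < j := Nat.pos_of_ne_zero fun h0 => hk ω (by simp [hj, h0])
      rw [gridTime_of_eq hj, ENNReal.ofReal_le_ofReal_iff']
      have : ¬ (j : ℝ) * δ ≤ 0 := not_le.2 (by positivity)
      simp only [this, or_false, Nat.cast_inj]
      exact ⟨fun h' => ⟨j, h', rfl⟩, fun ⟨i, hi, e⟩ => e ▸ hi⟩
  rw [h1]
  exact .iUnion fun j => .iUnion fun hj => F.mono hj _ (h j)

lemma expLaw_Ico_pos {r : ℝ} (hr : 0 < r) {a b : ℝ} (ha : 0 ≤ a) (hab : a < b) :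
    0 < expLaw r (Ico a b) := by
  have := isProbabilityMeasure_expLaw hr
  have h1 : Ico a b = Ici a \ Ici b := by
    ext t
    simp
  rw [h1, measure_sdiff (Ici_subset_Ici.2 hab.le) measurableSet_Ici.nullMeasurableSet
    (measure_ne_top _ _), expLaw_Ici hr ha, expLaw_Ici hr (ha.trans hab.le), tsub_pos_iff_lt]
  refine (ENNReal.ofReal_lt_ofReal_iff (Real.exp_pos _)).2 (Real.exp_lt_exp.2 ?_)
  nlinarith

lemma frequently_nhdsGT_of_ae_expLaw {r : ℝ} (hr : 0 < r) {p : ℝ → Prop}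
    (h : ∀ᵐ t ∂expLaw r, p t) {s : ℝ} (hs : 0 ≤ s) : ∃ᶠ t in 𝓝[>] s, p t := by
  intro hn
  obtain ⟨b, hb, hI⟩ := mem_nhdsGT_iff_exists_Ioo_subset.1 hn
  have hb : s < b := hb
  have h1 := expLaw_Ico_pos hr (a := (s + b) / 2) (b := b) (by linarith) (by linarith)
  refine h1.ne' (measure_mono_null (fun t ht => ?_) h)
  exact hI ⟨by linarith [ht.1], ht.2⟩

section Continuity

variable {Ω : Type*} {m : MeasurableSpace Ω} {P : Measure Ω} {X : ℝ → Ω → ℝ} {r : ℝ} {ψ : ℝ → ℝ}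

lemma measurableSet_ofReal_lt {τ : Ω → ℝ≥0∞} (hτ : Measurable τ) :
    MeasurableSet {z : ℝ × Ω | ENNReal.ofReal z.1 < τ z.2} :=
  measurableSet_lt (by fun_prop) (by fun_prop)

variable [IsProbabilityMeasure P]

lemma ae_ofReal_ne (hr : 0 < r) {τ : Ω → ℝ≥0∞} (hτ : Measurable τ) :
    ∀ᵐ z ∂(expLaw r).prod P, ENNReal.ofReal z.1 ≠ τ z.2 := by
  have := isProbabilityMeasure_expLaw hr
  have hm : MeasurableSet {z : ℝ × Ω | ENNReal.ofReal z.1 = τ z.2} :=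
    measurableSet_eq_fun (by fun_prop) (by fun_prop)
  have h0 : (expLaw r).prod P {z : ℝ × Ω | ENNReal.ofReal z.1 = τ z.2} = 0 := by
    rw [Measure.prod_apply_symm hm, lintegral_eq_zero_of_ae_eq_zero]
    refine .of_forall fun ω => ?_
    have h1 : ∀ᵐ t ∂expLaw r, t ≠ (τ ω).toReal :=
      (expLaw_absolutelyContinuous r).ae_le (compl_mem_ae_iff.2 (measure_singleton _))
    refine measure_eq_zero_iff_ae_notMem.2 ?_
    filter_upwards [h1, ae_expLaw_nonneg r] with t ht ht0 h2
    have h2 : ENNReal.ofReal t = τ ω := h2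
    exact ht (by rw [← h2, ENNReal.toReal_ofReal ht0])
  exact measure_eq_zero_iff_ae_notMem.1 h0

lemma tendsto_runPayoff (hr : 0 < r)
    (hi : Integrable (fun z => ψ (X z.1 z.2)) ((expLaw r).prod P)) (c : ℝ)
    {τ : ℕ → Ω → ℝ≥0∞} {σ : Ω → ℝ≥0∞} (hτ : ∀ n, Measurable (τ n)) (hσ : Measurable σ)
    (h : ∀ ω, Tendsto (fun n => τ n ω) atTop (𝓝 (σ ω))) :
    Tendsto (fun n => runPayoff P X r ψ c (τ n)) atTop (𝓝 (runPayoff P X r ψ c σ)) := by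
  have := isProbabilityMeasure_expLaw hr
  have hic : Integrable (fun z => ψ (X z.1 z.2) - c) ((expLaw r).prod P) :=
    hi.sub (integrable_const c)
  refine Tendsto.const_add _ ?_
  simp only [← integral_indicator (measurableSet_ofReal_lt (hτ _)),
    ← integral_indicator (measurableSet_ofReal_lt hσ)]
  refine tendsto_integral_of_dominated_convergence _
    (fun n => hic.aestronglyMeasurable.indicator (measurableSet_ofReal_lt (hτ n))) hic.norm
    (fun n => .of_forall fun z => norm_indicator_le_norm_self _ _) ?_
  filter_upwards [ae_ofReal_ne hr hσ] with z hz
  refine tendsto_nhds_of_eventually_eq ?_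
  rcases lt_or_gt_of_ne hz with hlt | hlt
  · filter_upwards [(h z.2).eventually_const_lt hlt] with n hn
    simp [indicator, hn, hlt]
  · filter_upwards [(h z.2).eventually_lt_const hlt] with n hn
    simp [indicator, hn.not_gt, hlt.not_gt]

end Continuity

/-- A discounted stopping problem with running payoff `ψ` and index `K`. -/
structure IsStopProblem {Ω : Type*} {m : MeasurableSpace Ω} (P : Measure Ω) (X : ℝ → Ω → ℝ)
    (F : Filtration ℝ m) (r : ℝ) (ψ K : ℝ → ℝ) : Prop where
  levy : IsLevy P X F
  pos : 0 < r
  meas : Measurable ψ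
  int : Integrable (fun z : ℝ × Ω => ψ (X z.1 z.2)) ((expLaw r).prod P)
  index_eq : ∀ y, K y = ∫ b, ψ (y + b) ∂infLaw P X r
  cont : Continuous K
  mono : Monotone K

lemma aemeasurable_liminf_nat {α : Type*} {mα : MeasurableSpace α} {μ : Measure α}
    {f : ℕ → α → ℝ≥0∞} (hf : ∀ n, AEMeasurable (f n) μ) :
    AEMeasurable (fun a => liminf (fun n => f n a) atTop) μ := by
  refine ⟨fun a => liminf (fun n => (hf n).mk _ a) atTop,
    .liminf fun n => (hf n).measurable_mk, ?_⟩
  filter_upwards [ae_all_iff.2 fun n => (hf n).ae_eq_mk] with a ha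
  simp only [ha]

lemma ae_ae_of_ae_prod_symm {α β : Type*} {mα : MeasurableSpace α} {mβ : MeasurableSpace β}
    {μ : Measure α} {ν : Measure β} [SFinite μ] [SFinite ν] {p : α × β → Prop}
    (h : ∀ᵐ z ∂μ.prod ν, p z) : ∀ᵐ y ∂ν, ∀ᵐ x ∂μ, p (x, y) :=
  Measure.ae_ae_of_ae_prod (p := fun z => p z.swap)
    (Measure.measurePreserving_swap.quasiMeasurePreserving.ae h)

namespace IsStopProblem

variable {Ω : Type*} {m : MeasurableSpace Ω} {P : Measure Ω} [IsProbabilityMeasure P]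
  {X : ℝ → Ω → ℝ} {F : Filtration ℝ m} {r : ℝ} {ψ K : ℝ → ℝ}

lemma value_add_le_runPayoff_gridTime (h : IsStopProblem P X F r ψ K) {δ : ℝ} (hδ : 0 < δ)
    {k : Ω → ℕ∞} (hk : IsGridStop F δ k) (c : ℝ) :
    gittinsValue P X r K c
        + ∫ z in stopRegion δ k, max (c - K (postMax X δ k z)) 0 ∂(expLaw r).prod P
      ≤ runPayoff P X r ψ c (gridTime δ k) := by
  have := isProbabilityMeasure_expLaw h.pos
  have h0 := h.levy.runPayoff_gridTime_sub_value h.pos hδ hk h.meas h.int h.index_eq c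
  obtain ⟨h1, -⟩ := h.levy.integrable_and_integral_sup h.pos h.meas h.int h.index_eq
  obtain ⟨h3, -⟩ := h.levy.integrable_and_integral_postMax h.pos hδ hk h.meas h.int h.index_eq
  have h4 : Integrable (fun z : ℝ × Ω => max (K (supIcc (fun u => X u z.2) 0 z.1) - c) 0)
      ((expLaw r).prod P) := (h1.sub (integrable_const c)).pos_part
  have h5 : IntegrableOn (fun z => max (K (postMax X δ k z) - c) 0) (stopRegion δ k)
      ((expLaw r).prod P) := (h3.sub (integrable_const c)).pos_part
  have h6 : IntegrableOn (fun z => max (c - K (postMax X δ k z)) 0) (stopRegion δ k)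
      ((expLaw r).prod P) := ((integrable_const c).sub h3).pos_part
  have h7 : ∫ z in stopRegion δ k, (K (postMax X δ k z) - c) ∂(expLaw r).prod P
      = ∫ z in stopRegion δ k, max (K (postMax X δ k z) - c) 0 ∂(expLaw r).prod P
        - ∫ z in stopRegion δ k, max (c - K (postMax X δ k z)) 0 ∂(expLaw r).prod P := by
    rw [← integral_sub h5 h6]
    refine integral_congr_ae (.of_forall fun z => ?_)
    simp only
    rw [← neg_sub (K (postMax X δ k z)) c, max_zero_sub_max_neg_zero_eq_self]
  have h8 : ∫ z in stopRegion δ k, max (K (postMax X δ k z) - c) 0 ∂(expLaw r).prod P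
      ≤ ∫ z in stopRegion δ k, max (K (supIcc (fun u => X u z.2) 0 z.1) - c) 0
        ∂(expLaw r).prod P := by
    refine setIntegral_mono_on h5 h4.integrableOn (IsLevy.measurableSet_stopRegion hk)
      fun z hz => ?_
    obtain ⟨j, hj, hkj⟩ := mem_iUnion.1 hz
    have hkj : k z.2 = j := hkj
    have hj : j * δ ≤ z.1 := hj
    have h9 : postMax X δ k z ≤ supIcc (fun u => X u z.2) 0 z.1 := by
      rw [postMax, hkj]
      exact (h.levy.cadlag z.2).supIcc_mono (by positivity) hj le_rfl
    have := h.mono h9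
    gcongr
  have h9 : ∫ z in stopRegion δ k, max (K (supIcc (fun u => X u z.2) 0 z.1) - c) 0
        ∂(expLaw r).prod P
      ≤ ∫ z, max (K (supIcc (fun u => X u z.2) 0 z.1) - c) 0 ∂(expLaw r).prod P :=
    setIntegral_le_integral h4 (.of_forall fun z => le_max_right _ _)
  linarith

lemma value_le_runPayoff (h : IsStopProblem P X F r ψ K) {σ : Ω → ℝ≥0∞} (hσ : IsOptional F σ)
    (c : ℝ) : gittinsValue P X r K c ≤ runPayoff P X r ψ c σ := by
  have hk := fun n => hσ.isGridStop (mesh_pos n)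
  have h1 : Tendsto (fun n => runPayoff P X r ψ c (gridTime (mesh n) (ceilIdx σ (mesh n)))) atTop
      (𝓝 (runPayoff P X r ψ c σ)) :=
    tendsto_runPayoff h.pos h.int c (fun n => ((hk n).isStopTimeE (mesh_pos n) fun ω => by
      simp only [ceilIdx]; split_ifs <;> simp [gridIdx]).isOptional.measurable) hσ.measurable
      (tendsto_gridTime_ceilIdx σ)
  refine ge_of_tendsto' h1 fun n => ?_
  have h2 := h.value_add_le_runPayoff_gridTime (mesh_pos n) (hk n) c
  have h3 : 0 ≤ ∫ z in stopRegion (mesh n) (ceilIdx σ (mesh n)),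
      max (c - K (postMax X (mesh n) (ceilIdx σ (mesh n)) z)) 0 ∂(expLaw r).prod P :=
    integral_nonneg fun z => le_max_right _ _
  linarith

/-- An optimal optional time stops in the region where the index is at least `c`. -/
lemma le_index_of_runPayoff_le (h : IsStopProblem P X F r ψ K) {σ : Ω → ℝ≥0∞}
    (hσ : IsOptional F σ) {c : ℝ} (hle : runPayoff P X r ψ c σ ≤ gittinsValue P X r K c) :
    ∀ᵐ ω ∂P, σ ω ≠ ⊤ → c ≤ K (X (σ ω).toReal ω) := by
  have := isProbabilityMeasure_expLaw h.pos
  have hk := fun n => hσ.isGridStop (mesh_pos n)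
  set k := fun n => ceilIdx σ (mesh n) with hkdef
  have h1 : Tendsto (fun n => runPayoff P X r ψ c (gridTime (mesh n) (k n))) atTop
      (𝓝 (runPayoff P X r ψ c σ)) :=
    tendsto_runPayoff h.pos h.int c (fun n => ((hk n).isStopTimeE (mesh_pos n) fun ω => by
      simp only [ceilIdx]; split_ifs <;> simp [gridIdx]).isOptional.measurable) hσ.measurable
      (tendsto_gridTime_ceilIdx σ)
  have h6 : ∀ n, IntegrableOn (fun z => max (c - K (postMax X (mesh n) (k n) z)) 0)
      (stopRegion (mesh n) (k n)) ((expLaw r).prod P) := fun n =>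
    ((integrable_const c).sub (h.levy.integrable_and_integral_postMax h.pos (mesh_pos n) (hk n)
      h.meas h.int h.index_eq).1).pos_part
  have h2 : Tendsto (fun n => ∫ z in stopRegion (mesh n) (k n),
      max (c - K (postMax X (mesh n) (k n) z)) 0 ∂(expLaw r).prod P) atTop (𝓝 0) := by
    have h3 : Tendsto (fun n => runPayoff P X r ψ c (gridTime (mesh n) (k n))
        - gittinsValue P X r K c) atTop (𝓝 0) := by
      have h4 := h1.sub_const (gittinsValue P X r K c)
      rwa [sub_eq_zero.2 (le_antisymm hle (h.value_le_runPayoff hσ c))] at h4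
    refine squeeze_zero (fun n => integral_nonneg fun z => le_max_right _ _) (fun n => ?_) h3
    have := h.value_add_le_runPayoff_gridTime (mesh_pos n) (hk n) c
    linarith
  set f : ℕ → ℝ × Ω → ℝ≥0∞ := fun n => (stopRegion (mesh n) (k n)).indicator
    fun z => ENNReal.ofReal (max (c - K (postMax X (mesh n) (k n) z)) 0) with hf
  have hms := fun n => IsLevy.measurableSet_stopRegion (hk n)
  have hfm : ∀ n, AEMeasurable (f n) ((expLaw r).prod P) := fun n =>
    (aemeasurable_indicator_iff (hms n)).2 (h6 n).aemeasurable.ennreal_ofReal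
  have h3 : Tendsto (fun n => ∫⁻ z, f n z ∂(expLaw r).prod P) atTop (𝓝 0) := by
    have h4 := ENNReal.tendsto_ofReal h2
    rw [ENNReal.ofReal_zero] at h4
    refine h4.congr fun n => ?_
    rw [ofReal_integral_eq_lintegral_ofReal (h6 n) (.of_forall fun z => le_max_right _ _),
      lintegral_indicator (hms n)]
  have h4 : ∫⁻ z, liminf (fun n => f n z) atTop ∂(expLaw r).prod P = 0 :=
    le_antisymm ((lintegral_liminf_le' hfm).trans h3.liminf_eq.le) zero_le
  rw [lintegral_eq_zero_iff' (aemeasurable_liminf_nat hfm)] at h4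
  have h5 : ∀ᵐ ω ∂P, ∀ᵐ t ∂expLaw r, liminf (fun n => f n (t, ω)) atTop = 0 :=
    ae_ae_of_ae_prod_symm h4
  filter_upwards [h5] with ω hω hfin
  set s := (σ ω).toReal with hs
  have hs0 : 0 ≤ s := ENNReal.toReal_nonneg
  have hσs : σ ω = ENNReal.ofReal s := (ENNReal.ofReal_toReal hfin).symm
  have h7 : Tendsto (fun t => K (supIcc (fun u => X u ω) s t)) (𝓝[>] s) (𝓝 (K (X s ω))) :=
    (h.cont.tendsto _).comp (((h.levy.cadlag ω).tendsto_supIcc_right s).mono_left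
      (nhdsWithin_mono _ Ioi_subset_Ici_self))
  refine ge_of_tendsto_of_frequently h7 <| ((frequently_nhdsGT_of_ae_expLaw h.pos hω
    hs0).and_eventually self_mem_nhdsWithin).mono fun t ⟨ht, hst⟩ => ?_
  have hst : s < t := hst
  have h8 : ∀ᶠ n in atTop,
      ENNReal.ofReal (max (c - K (supIcc (fun u => X u ω) s t)) 0) ≤ f n (t, ω) := by
    have h9 : σ ω < ENNReal.ofReal t := by
      rw [hσs]
      exact (ENNReal.ofReal_lt_ofReal_iff (hs0.trans_lt hst)).2 hst
    filter_upwards [(tendsto_gridTime_ceilIdx σ ω).eventually_lt_const h9] with n hn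
    have hmem : (t, ω) ∈ stopRegion (mesh n) (k n) :=
      (gridTime_le_iff (mesh_pos n) (k n) (z := (t, ω)) (hs0.trans hst.le)).1 hn.le
    rw [hf]
    simp only [indicator_of_mem hmem]
    have hkn : k n ω = gridIdx (mesh n) s := by simp [hkdef, ceilIdx, hfin, hs]
    have hle : gridIdx (mesh n) s * mesh n ≤ t := by
      rw [gridTime_of_eq hkn] at hn
      exact ((ENNReal.ofReal_lt_ofReal_iff (hs0.trans_lt hst)).1 hn).le
    have h10 : postMax X (mesh n) (k n) (t, ω) ≤ supIcc (fun u => X u ω) s t := by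
      simp only [postMax, hkn, ENat.toNat_natCast]
      exact (h.levy.cadlag ω).supIcc_mono (lt_gridIdx_mul (mesh_pos n) s).le hle le_rfl
    have := h.mono h10
    gcongr
  have h11 := le_liminf_of_le (by isBoundedDefault) h8
  rw [ht] at h11
  have h12 := ENNReal.ofReal_eq_zero.1 (le_antisymm h11 zero_le)
  linarith [le_max_left (c - K (supIcc (fun u => X u ω) s t)) 0]

end IsStopProblem

open Classical in
/-- The index of the first positive grid point at which `K X` exceeds `c`. -/
def hitIdx {Ω : Type*} (X : ℝ → Ω → ℝ) (K : ℝ → ℝ) (c δ : ℝ) (ω : Ω) : ℕ∞ :=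
  if h : ∃ j : ℕ, 0 < j ∧ c < K (X (j * δ) ω) then (Nat.find h : ℕ) else ⊤

section hitIdx

variable {Ω : Type*} {X : ℝ → Ω → ℝ} {K : ℝ → ℝ} {c δ : ℝ} {ω : Ω} {j : ℕ}

lemma hitIdx_eq_coe_iff : hitIdx X K c δ ω = j ↔
    (0 < j ∧ c < K (X (j * δ) ω)) ∧ ∀ i < j, ¬ (0 < i ∧ c < K (X (i * δ) ω)) := by
  classical
  unfold hitIdx
  split_ifs with h
  · rw [Nat.cast_inj, ← Nat.find_eq_iff h]
  · simp only [ENat.top_ne_natCast, false_iff, not_and]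
    exact fun hj => absurd ⟨j, hj⟩ h

lemma hitIdx_le (hj : 0 < j) (h : c < K (X (j * δ) ω)) : hitIdx X K c δ ω ≤ j := by
  classical
  have h' : ∃ j : ℕ, 0 < j ∧ c < K (X (j * δ) ω) := ⟨j, hj, h⟩
  rw [hitIdx, dif_pos h', Nat.cast_le]
  exact Nat.find_min' h' ⟨hj, h⟩

lemma hitIdx_ne_zero : hitIdx X K c δ ω ≠ 0 := fun h =>
  absurd (hitIdx_eq_coe_iff (j := 0).1 h).1.1 (lt_irrefl 0)

/-- The first entrance time of `K X` into `(c, ∞)`. -/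
def hitTime (X : ℝ → Ω → ℝ) (K : ℝ → ℝ) (c : ℝ) (ω : Ω) : ℝ≥0∞ :=
  sInf {e | ∃ u : ℝ, 0 ≤ u ∧ e = ENNReal.ofReal u ∧ c < K (X u ω)}

lemma hitTime_le_gridTime (hδ : 0 < δ) : hitTime X K c ω ≤ gridTime δ (hitIdx X K c δ) ω := by
  cases h : hitIdx X K c δ ω with
  | top => rw [gridTime_of_eq_top hδ h]; exact le_top
  | coe j =>
    rw [gridTime_of_eq h]
    exact sInf_le ⟨j * δ, by positivity, rfl, (hitIdx_eq_coe_iff.1 h).1.2⟩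

lemma eventually_lt_gridIdx (hK : Continuous K) (hX : IsCadlag fun s => X s ω) {u : ℝ}
    (hu : 0 ≤ u) (h : c < K (X u ω)) :
    ∀ᶠ n in atTop, c < K (X (gridIdx (mesh n) u * mesh n) ω) :=
  ((hK.tendsto _).comp ((hX.rightCont u).tendsto.comp
    (tendsto_gridIdx_mul hu))).eventually_const_lt h

lemma tendsto_gridTime_hitIdx (hK : Continuous K) (hX : IsCadlag fun s => X s ω) :
    Tendsto (fun n => gridTime (mesh n) (hitIdx X K c (mesh n)) ω) atTop
      (𝓝 (hitTime X K c ω)) := by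
  refine tendsto_order.2 ⟨fun a ha => .of_forall fun n => ha.trans_le
    (hitTime_le_gridTime (mesh_pos n)), fun a ha => ?_⟩
  obtain ⟨_, ⟨u, hu, rfl, huc⟩, hua⟩ := sInf_lt_iff.1 ha
  have h1 : Tendsto (fun n => ENNReal.ofReal (gridIdx (mesh n) u * mesh n)) atTop
      (𝓝 (ENNReal.ofReal u)) :=
    ENNReal.tendsto_ofReal ((tendsto_gridIdx_mul hu).mono_right nhdsWithin_le_nhds)
  filter_upwards [h1.eventually_lt_const hua, eventually_lt_gridIdx hK hX hu huc] with n hn1 hn2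
  refine lt_of_le_of_lt ?_ hn1
  have h2 := hitIdx_le (K := K) (j := gridIdx (mesh n) u) (Nat.succ_pos _) hn2
  obtain ⟨i, hi⟩ := ENat.ne_top_iff_exists.1 (ne_top_of_le_ne_top (ENat.natCast_ne_top _) h2)
  rw [gridTime_of_eq hi.symm]
  rw [← hi, Nat.cast_le] at h2
  have := (mesh_pos n).le
  gcongr

end hitIdx

lemma exists_lt_of_continuousAt_supIcc {f : ℝ → ℝ} {t a : ℝ}
    (ht : 0 < t) (hc : ContinuousAt (fun s => supIcc f 0 (max s 0)) t) (ha : a < supIcc f 0 t) :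
    ∃ u, 0 ≤ u ∧ u < t ∧ a < f u := by
  have ha' : a < supIcc f 0 (max t 0) := by rwa [max_eq_left ht.le]
  have h1 : ∀ᶠ s in 𝓝 t, a < supIcc f 0 (max s 0) := hc.eventually_const_lt ha'
  obtain ⟨s, ⟨hs1, hs0⟩, hst⟩ := (((h1.and (lt_mem_nhds ht)).filter_mono
    nhdsWithin_le_nhds).and (self_mem_nhdsWithin (s := Iio t))).exists
  rw [max_eq_left (le_of_lt hs0)] at hs1
  obtain ⟨_, ⟨u, hu, rfl⟩, hau⟩ := exists_lt_of_lt_csSup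
    ((nonempty_Icc.2 (le_of_lt hs0)).image f) hs1
  exact ⟨u, hu.1, hu.2.trans_lt hst, hau⟩

lemma IsCadlag.countable_not_continuousAt_supIcc {f : ℝ → ℝ} (hf : IsCadlag f) :
    {t | ¬ ContinuousAt (fun s => supIcc f 0 (max s 0)) t}.Countable :=
  Monotone.countable_not_continuousAt fun _ _ hst =>
    hf.supIcc_mono le_rfl (le_max_right _ _) (max_le_max_right 0 hst)

namespace IsStopProblem

variable {Ω : Type*} {m : MeasurableSpace Ω} {P : Measure Ω}
  {X : ℝ → Ω → ℝ} {F : Filtration ℝ m} {r : ℝ} {ψ K : ℝ → ℝ}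

lemma isGridStop_hitIdx (h : IsStopProblem P X F r ψ K) (c : ℝ) {δ : ℝ} (hδ : 0 < δ) :
    IsGridStop F δ (hitIdx X K c δ) := fun j => by
  have hm : ∀ i ≤ j, MeasurableSet[F (j * δ)] {ω | 0 < i ∧ c < K (X (i * δ) ω)} := fun i hi => by
    have h1 : MeasurableSet[F (i * δ)] {ω | c < K (X (i * δ) ω)} :=
      (h.mono.measurable.comp (h.levy.adapted (i * δ))) measurableSet_Ioi
    have h2 : MeasurableSet[F (j * δ)] {ω | c < K (X (i * δ) ω)} := F.mono (by gcongr) _ h1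
    exact (MeasurableSet.const _).inter h2
  simp only [hitIdx_eq_coe_iff]
  refine (hm j le_rfl).inter ?_
  have h3 : {ω | ∀ i < j, ¬ (0 < i ∧ c < K (X (i * δ) ω))}
      = ⋂ i, ⋂ _ : i < j, {ω | 0 < i ∧ c < K (X (i * δ) ω)}ᶜ := by
    ext ω
    simp
  change MeasurableSet[F (j * δ)] {ω | ∀ i < j, ¬ (0 < i ∧ c < K (X (i * δ) ω))}
  rw [h3]
  exact .iInter fun i => .iInter fun hi => (hm i hi.le).compl

lemma isStopTimeE_hitIdx (h : IsStopProblem P X F r ψ K) (c : ℝ) {δ : ℝ} (hδ : 0 < δ) :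
    IsStopTimeE F (gridTime δ (hitIdx X K c δ)) :=
  (h.isGridStop_hitIdx c hδ).isStopTimeE hδ fun _ => hitIdx_ne_zero

lemma isOptional_hitTime (h : IsStopProblem P X F r ψ K) (c : ℝ) :
    IsOptional F (hitTime X K c) := fun t => by
  have h1 : {ω | hitTime X K c ω < ENNReal.ofReal t}
      = ⋃ n, {ω | gridTime (mesh n) (hitIdx X K c (mesh n)) ω < ENNReal.ofReal t} := by
    ext ω
    simp only [mem_iUnion, Set.mem_ofPred_eq]
    exact ⟨fun hω => ((tendsto_gridTime_hitIdx h.cont (h.levy.cadlag ω)).eventually_lt_const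
      hω).exists, fun ⟨n, hn⟩ => (hitTime_le_gridTime (mesh_pos n)).trans_lt hn⟩
  rw [h1]
  exact .iUnion fun n => (h.isStopTimeE_hitIdx c (mesh_pos n)).isOptional t

/-- On and after the hitting index, the index of the running maximum exceeds `c`. -/
lemma le_index_postMax (h : IsStopProblem P X F r ψ K) (c : ℝ) {δ : ℝ} {z : ℝ × Ω} {u : ℝ}
    (hu : ((hitIdx X K c δ z.2).toNat : ℝ) * δ ≤ u) (hut : u ≤ z.1) :
    K (X u z.2) ≤ K (postMax X δ (hitIdx X K c δ) z) :=
  h.mono ((h.levy.cadlag z.2).le_supIcc (f := fun s => X s z.2) ⟨hu, hut⟩)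

lemma lt_index_postMax (h : IsStopProblem P X F r ψ K) (c : ℝ) {δ : ℝ} {z : ℝ × Ω}
    (hz : z ∈ stopRegion δ (hitIdx X K c δ)) : c < K (postMax X δ (hitIdx X K c δ) z) := by
  obtain ⟨j, hj, hkj⟩ := mem_iUnion.1 hz
  have hkj : hitIdx X K c δ z.2 = j := hkj
  have hj : j * δ ≤ z.1 := hj
  have h1 := h.le_index_postMax c (K := K) (δ := δ) (z := z) (u := j * δ) (by simp [hkj]) hj
  exact (hitIdx_eq_coe_iff.1 hkj).1.2.trans_le h1

lemma le_liminf_hitIdx (h : IsStopProblem P X F r ψ K) (c : ℝ) {ω : Ω} {t : ℝ} (ht : 0 < t)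
    (hc : ContinuousAt (fun s => supIcc (fun u => X u ω) 0 (max s 0)) t) :
    ENNReal.ofReal (max (K (supIcc (fun u => X u ω) 0 t) - c) 0)
      ≤ liminf (fun n => (stopRegion (mesh n) (hitIdx X K c (mesh n))).indicator
        (fun z => ENNReal.ofReal (K (postMax X (mesh n) (hitIdx X K c (mesh n)) z) - c)) (t, ω))
        atTop := by
  set M := supIcc (fun u => X u ω) 0 t with hM
  rcases le_or_gt (K M) c with hle | hlt
  · simp [hle]
  rw [max_eq_left (sub_nonneg.2 hlt.le)]
  have h1 : Tendsto (fun a => ENNReal.ofReal (K a - c)) (𝓝[<] M) (𝓝 (ENNReal.ofReal (K M - c))) :=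
    ENNReal.tendsto_ofReal (((h.cont.tendsto M).mono_left nhdsWithin_le_nhds).sub_const c)
  have h2 : ∀ᶠ a in 𝓝[<] M, c < K a :=
    ((h.cont.tendsto M).mono_left nhdsWithin_le_nhds).eventually_const_lt hlt
  refine le_of_tendsto h1 ?_
  filter_upwards [h2, self_mem_nhdsWithin] with a hca haM
  obtain ⟨u, hu0, hut, hau⟩ :=
    exists_lt_of_continuousAt_supIcc ht hc haM
  refine le_liminf_of_le (by isBoundedDefault) ?_
  have h3 : Tendsto (fun n => (gridIdx (mesh n) u * mesh n : ℝ)) atTop (𝓝 u) :=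
    (tendsto_gridIdx_mul hu0).mono_right nhdsWithin_le_nhds
  have h4 : ∀ᶠ n in atTop, a < X (gridIdx (mesh n) u * mesh n) ω :=
    (((h.levy.cadlag ω).rightCont u).tendsto.comp (tendsto_gridIdx_mul hu0)).eventually_const_lt hau
  filter_upwards [h3.eventually_lt_const hut, h4] with n hn1 hn2
  have h5 : K a ≤ K (X (gridIdx (mesh n) u * mesh n) ω) := h.mono hn2.le
  have h6 := hitIdx_le (K := K) (j := gridIdx (mesh n) u) (Nat.succ_pos _) (hca.trans_le h5)
  obtain ⟨i, hi⟩ := ENat.ne_top_iff_exists.1 (ne_top_of_le_ne_top (ENat.natCast_ne_top _) h6)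
  have h7 : (i : ℝ) * mesh n ≤ gridIdx (mesh n) u * mesh n := by
    rw [← hi, Nat.cast_le] at h6
    have := (mesh_pos n).le
    gcongr
  have hmem : (t, ω) ∈ stopRegion (mesh n) (hitIdx X K c (mesh n)) :=
    mem_iUnion.2 ⟨i, h7.trans hn1.le, hi.symm⟩
  rw [indicator_of_mem hmem]
  refine ENNReal.ofReal_le_ofReal (sub_le_sub_right (h5.trans ?_) c)
  exact h.le_index_postMax c (z := (t, ω)) (by simpa [← hi] using h7) hn1.le

variable [IsProbabilityMeasure P]

lemma tendsto_runPayoff_hitIdx (h : IsStopProblem P X F r ψ K) (c : ℝ) :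
    Tendsto (fun n => runPayoff P X r ψ c (gridTime (mesh n) (hitIdx X K c (mesh n)))) atTop
      (𝓝 (gittinsValue P X r K c)) := by
  have := isProbabilityMeasure_expLaw h.pos
  set k := fun n => hitIdx X K c (mesh n) with hkdef
  have hk : ∀ n, IsGridStop F (mesh n) (k n) := fun n => h.isGridStop_hitIdx c (mesh_pos n)
  have hms := fun n => IsLevy.measurableSet_stopRegion (hk n)
  obtain ⟨h1, -⟩ := h.levy.integrable_and_integral_sup h.pos h.meas h.int h.index_eq
  have h2 : Integrable (fun z : ℝ × Ω => max (K (supIcc (fun u => X u z.2) 0 z.1) - c) 0)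
      ((expLaw r).prod P) := (h1.sub (integrable_const c)).pos_part
  have h3 : ∀ n, IntegrableOn (fun z => K (postMax X (mesh n) (k n) z) - c)
      (stopRegion (mesh n) (k n)) ((expLaw r).prod P) := fun n =>
    (h.levy.integrable_and_integral_postMax h.pos (mesh_pos n) (hk n)
      h.meas h.int h.index_eq).1.sub (integrable_const c)
  set I := ∫ z, max (K (supIcc (fun u => X u z.2) 0 z.1) - c) 0 ∂(expLaw r).prod P with hI
  set J : ℕ → ℝ := fun n => ∫ z in stopRegion (mesh n) (k n),
    (K (postMax X (mesh n) (k n) z) - c) ∂(expLaw r).prod P with hJ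
  have h4 : ∀ n, runPayoff P X r ψ c (gridTime (mesh n) (k n))
      = gittinsValue P X r K c + (I - J n) :=
    fun n => by
      have := h.levy.runPayoff_gridTime_sub_value h.pos (mesh_pos n) (hk n) h.meas h.int
        h.index_eq c
      rw [← this]
      ring
  have hJI : ∀ n, J n ≤ I := fun n => by
    have h5 := h.value_le_runPayoff (h.isStopTimeE_hitIdx c (mesh_pos n)).isOptional c
    have h6 := h4 n
    simp only [hkdef] at h6
    linarith
  have hJ0 : ∀ n, 0 ≤ J n := fun n =>
    setIntegral_nonneg (hms n) fun z hz => sub_nonneg.2 (h.lt_index_postMax c hz).le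
  set f : ℕ → ℝ × Ω → ℝ≥0∞ := fun n => (stopRegion (mesh n) (k n)).indicator
    fun z => ENNReal.ofReal (K (postMax X (mesh n) (k n) z) - c) with hf
  have hfm : ∀ n, AEMeasurable (f n) ((expLaw r).prod P) := fun n =>
    (aemeasurable_indicator_iff (hms n)).2 (h3 n).aemeasurable.ennreal_ofReal
  have hfJ : ∀ n, ∫⁻ z, f n z ∂(expLaw r).prod P = ENNReal.ofReal (J n) := fun n => by
    rw [hJ, ofReal_integral_eq_lintegral_ofReal (h3 n), lintegral_indicator (hms n)]
    filter_upwards [ae_restrict_mem (hms n)] with z hz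
    exact sub_nonneg.2 (h.lt_index_postMax c hz).le
  have h5 : ENNReal.ofReal I ≤ liminf (fun n => ENNReal.ofReal (J n)) atTop := by
    rw [hI, ofReal_integral_eq_lintegral_ofReal h2 (.of_forall fun z => le_max_right _ _)]
    simp only [← hfJ]
    refine le_trans ?_ (lintegral_liminf_le' hfm)
    rw [lintegral_prod_symm _ h2.aemeasurable.ennreal_ofReal,
      lintegral_prod_symm _ (aemeasurable_liminf_nat hfm)]
    refine lintegral_mono fun ω => lintegral_mono_ae ?_
    have h6 : ∀ᵐ t ∂expLaw r, t ≠ 0 :=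
      (expLaw_absolutelyContinuous r).ae_le (compl_mem_ae_iff.2 (measure_singleton _))
    have h7 : ∀ᵐ t ∂expLaw r,
        ContinuousAt (fun s => supIcc (fun u => X u ω) 0 (max s 0)) t :=
      (expLaw_absolutelyContinuous r).ae_le
        ((h.levy.cadlag ω).countable_not_continuousAt_supIcc.measure_zero _)
    filter_upwards [h6, h7, ae_expLaw_nonneg r] with t ht0 htc ht
    exact h.le_liminf_hitIdx c (lt_of_le_of_ne ht ht0.symm) htc
  have h6 : Tendsto (fun n => ENNReal.ofReal (J n)) atTop (𝓝 (ENNReal.ofReal I)) :=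
    tendsto_of_le_liminf_of_limsup_le h5
      (limsup_le_of_le (by isBoundedDefault)
        (.of_forall fun n => ENNReal.ofReal_le_ofReal (hJI n)))
  have h7 : Tendsto J atTop (𝓝 I) := by
    have h8 := (ENNReal.tendsto_toReal ENNReal.ofReal_ne_top).comp h6
    rw [ENNReal.toReal_ofReal ((hJ0 0).trans (hJI 0))] at h8
    exact h8.congr fun n => ENNReal.toReal_ofReal (hJ0 n)
  simp only [hkdef] at h4
  simp only [h4]
  simpa using (h7.const_sub I).const_add (gittinsValue P X r K c)

lemma runPayoff_hitTime (h : IsStopProblem P X F r ψ K) (c : ℝ) :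
    runPayoff P X r ψ c (hitTime X K c) = gittinsValue P X r K c :=
  tendsto_nhds_unique (tendsto_runPayoff h.pos h.int c
    (fun n => (h.isStopTimeE_hitIdx c (mesh_pos n)).isOptional.measurable)
    (h.isOptional_hitTime c).measurable
    fun ω => tendsto_gridTime_hitIdx h.cont (h.levy.cadlag ω)) (h.tendsto_runPayoff_hitIdx c)

end IsStopProblem

/-- The first time at which `K X` is at least `c`. -/
def passageTime {Ω : Type*} (X : ℝ → Ω → ℝ) (K : ℝ → ℝ) (c : ℝ) (ω : Ω) : ℝ≥0∞ :=
  sInf {e | ∃ u : ℝ, 0 ≤ u ∧ e = ENNReal.ofReal u ∧ c ≤ K (X u ω)}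

/-- The limit of the hitting times of levels increasing to `c`. -/
def limHitTime {Ω : Type*} (X : ℝ → Ω → ℝ) (K : ℝ → ℝ) (c : ℝ) (ω : Ω) : ℝ≥0∞ :=
  ⨆ n, hitTime X K (c - mesh n) ω

lemma hitTime_mono {Ω : Type*} {X : ℝ → Ω → ℝ} {K : ℝ → ℝ} {ω : Ω} {c c' : ℝ} (h : c' ≤ c) :
    hitTime X K c' ω ≤ hitTime X K c ω :=
  sInf_le_sInf fun _ ⟨u, hu, he, hc⟩ => ⟨u, hu, he, h.trans_lt hc⟩

lemma antitone_mesh : Antitone mesh := fun _ _ h => Nat.one_div_le_one_div h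

namespace IsStopProblem

variable {Ω : Type*} {m : MeasurableSpace Ω} {P : Measure Ω}
  {X : ℝ → Ω → ℝ} {F : Filtration ℝ m} {r : ℝ} {ψ K : ℝ → ℝ}

lemma isOptional_limHitTime (h : IsStopProblem P X F r ψ K) (c : ℝ) :
    IsOptional F (limHitTime X K c) :=
  .iSup fun _ => h.isOptional_hitTime _

lemma gittinsValue_eq_of_le (h : IsStopProblem P X F r ψ K) {c : ℝ} (hc : c ≤ K 0) :
    gittinsValue P X r K c = c := by
  have := isProbabilityMeasure_expLaw h.pos
  rw [gittinsValue, integral_eq_zero_of_ae, sub_zero]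
  have h1 : ∀ᵐ z ∂(expLaw r).prod P, X 0 z.2 = 0 :=
    Measure.quasiMeasurePreserving_snd.ae h.levy.zero
  filter_upwards [h1, IsLevy.ae_prod_nonneg (P := P) h.pos] with z hz hz0
  have h2 : X 0 z.2 ≤ supIcc (fun u => X u z.2) 0 z.1 :=
    (h.levy.cadlag z.2).le_supIcc (f := fun s => X s z.2) ⟨le_rfl, hz0⟩
  rw [hz] at h2
  exact max_eq_right (by linarith [h.mono h2])

variable [IsProbabilityMeasure P]

lemma runPayoff_sub (h : IsStopProblem P X F r ψ K) {τ : Ω → ℝ≥0∞} (c c' : ℝ) :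
    runPayoff P X r ψ c τ - runPayoff P X r ψ c' τ = (c - c')
      * (1 - ((expLaw r).prod P).real {z : ℝ × Ω | ENNReal.ofReal z.1 < τ z.2}) := by
  have := isProbabilityMeasure_expLaw h.pos
  rw [runPayoff, runPayoff, integral_sub h.int.integrableOn (integrable_const c),
    integral_sub h.int.integrableOn (integrable_const c'), setIntegral_const, setIntegral_const]
  simp only [smul_eq_mul]
  ring

lemma runPayoff_mono (h : IsStopProblem P X F r ψ K) (τ : Ω → ℝ≥0∞) {c c' : ℝ} (hc : c' ≤ c) :
    runPayoff P X r ψ c' τ ≤ runPayoff P X r ψ c τ := by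
  have := isProbabilityMeasure_expLaw h.pos
  have h1 := h.runPayoff_sub (τ := τ) c c'
  have h2 : ((expLaw r).prod P).real {z : ℝ × Ω | ENNReal.ofReal z.1 < τ z.2} ≤ 1 :=
    measureReal_le_one
  nlinarith

lemma runPayoff_le_add (h : IsStopProblem P X F r ψ K) (τ : Ω → ℝ≥0∞) {c c' : ℝ} (hc : c' ≤ c) :
    runPayoff P X r ψ c τ ≤ runPayoff P X r ψ c' τ + (c - c') := by
  have h1 := h.runPayoff_sub (τ := τ) c c'
  have h2 : 0 ≤ ((expLaw r).prod P).real {z : ℝ × Ω | ENNReal.ofReal z.1 < τ z.2} :=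
    measureReal_nonneg
  nlinarith

lemma runPayoff_limHitTime (h : IsStopProblem P X F r ψ K) (c : ℝ) :
    runPayoff P X r ψ c (limHitTime X K c) = gittinsValue P X r K c := by
  refine le_antisymm ?_ (h.value_le_runPayoff (h.isOptional_limHitTime c) c)
  have h1 : Tendsto (fun n => runPayoff P X r ψ c (hitTime X K (c - mesh n))) atTop
      (𝓝 (runPayoff P X r ψ c (limHitTime X K c))) :=
    tendsto_runPayoff h.pos h.int c (fun n => (h.isOptional_hitTime _).measurable)
      (h.isOptional_limHitTime c).measurable fun ω => tendsto_atTop_iSup fun i j hij =>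
        hitTime_mono (sub_le_sub_left (antitone_mesh hij) c)
  have h2 : Tendsto (fun n => gittinsValue P X r K c + mesh n) atTop
      (𝓝 (gittinsValue P X r K c)) := by
    simpa using tendsto_mesh.const_add (gittinsValue P X r K c)
  refine le_of_tendsto_of_tendsto' h1 h2 fun n => ?_
  have hc : c - mesh n ≤ c := by linarith [mesh_pos n]
  have h3 := h.runPayoff_le_add (hitTime X K (c - mesh n)) hc
  have h4 := h.value_le_runPayoff (h.isOptional_hitTime c) (c - mesh n)
  have h5 := h.runPayoff_mono (hitTime X K c) hc
  rw [h.runPayoff_hitTime] at h3 h5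
  linarith

lemma passageTime_ae_eq (h : IsStopProblem P X F r ψ K) (c : ℝ) :
    passageTime X K c =ᵐ[P] limHitTime X K c := by
  filter_upwards [h.le_index_of_runPayoff_le (h.isOptional_limHitTime c)
    (h.runPayoff_limHitTime c).le] with ω hω
  refine le_antisymm ?_ (iSup_le fun n => sInf_le_sInf fun e ⟨u, hu, he, hc⟩ =>
    ⟨u, hu, he, by linarith [mesh_pos n]⟩)
  by_cases hfin : limHitTime X K c ω = ⊤
  · rw [hfin]
    exact le_top
  · exact sInf_le ⟨_, ENNReal.toReal_nonneg, (ENNReal.ofReal_toReal hfin).symm, hω hfin⟩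

lemma gittinsValue_lt (h : IsStopProblem P X F r ψ K) {c : ℝ} (hc : K 0 < c) :
    gittinsValue P X r K c < c := by
  have := isProbabilityMeasure_expLaw h.pos
  obtain ⟨h1, -⟩ := h.levy.integrable_and_integral_sup h.pos h.meas h.int h.index_eq
  have h2 : Integrable (fun z : ℝ × Ω => max (c - K (supIcc (fun u => X u z.2) 0 z.1)) 0)
      ((expLaw r).prod P) := ((integrable_const c).sub h1).pos_part
  have h3 : 0 ≤ fun z : ℝ × Ω => max (c - K (supIcc (fun u => X u z.2) 0 z.1)) 0 :=
    fun z => le_max_right _ _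
  rw [gittinsValue, sub_lt_self_iff]
  refine lt_of_le_of_ne (integral_nonneg h3) fun h0 => ?_
  have h4 := (integral_eq_zero_iff_of_nonneg h3 h2).1 h0.symm
  obtain ⟨ω, hω, hX⟩ := ((ae_ae_of_ae_prod_symm h4).and h.levy.zero).exists
  have h5 : Tendsto (fun t => K (supIcc (fun u => X u ω) 0 t)) (𝓝[>] 0) (𝓝 (K (X 0 ω))) :=
    (h.cont.tendsto _).comp (((h.levy.cadlag ω).tendsto_supIcc_right 0).mono_left
      (nhdsWithin_mono _ Ioi_subset_Ici_self))
  rw [hX] at h5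
  refine hc.not_ge (ge_of_tendsto_of_frequently h5
    ((frequently_nhdsGT_of_ae_expLaw h.pos hω le_rfl).mono fun t ht => ?_))
  have ht : max (c - K (supIcc (fun u => X u ω) 0 t)) 0 = 0 := ht
  linarith [le_max_left (c - K (supIcc (fun u => X u ω) 0 t)) 0]

end IsStopProblem

section Bridge

variable {Ω : Type*} {m : MeasurableSpace Ω} {P : Measure Ω}
  {X : ℝ → Ω → ℝ} {F : Filtration ℝ m} {r : ℝ} {g : ℝ → ℝ} {x : ℝ}

lemma IsLevy.runInf_ae_eq (h : IsLevy P X F) (hr : 0 < r) :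
    (fun z : ℝ × Ω => sInf ((fun u => X u z.2) '' Icc 0 z.1) - X 0 z.2)
      =ᵐ[(expLaw r).prod P] fun z => runInf X z.1 z.2 := by
  have := isProbabilityMeasure_expLaw hr
  have h1 : ∀ᵐ z ∂(expLaw r).prod P, X 0 z.2 = 0 :=
    Measure.quasiMeasurePreserving_snd.ae h.zero
  filter_upwards [h1] with z hz
  rw [hz, sub_zero, runInf]

lemma IsLevy.integrable_infLaw_iff (h : IsLevy P X F) (hr : 0 < r) {φ : ℝ → ℝ}
    (hφ : Continuous φ) : Integrable φ (infLaw P X r) ↔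
      Integrable (fun z : ℝ × Ω => φ (runInf X z.1 z.2)) ((expLaw r).prod P) := by
  rw [infLaw, expTimeLaw, integrable_map_measure hφ.aestronglyMeasurable
    (h.aemeasurable_functional isGridLimit_min 0 _ (IsLevy.ae_prod_nonneg hr))]
  exact integrable_congr ((h.runInf_ae_eq hr).fun_comp φ)

variable [IsProbabilityMeasure P]

lemma integrable_expLaw_prod_of_discounted (hr : 0 < r) {φ : ℝ × Ω → ℝ}
    (h : Integrable (fun p => φ p * Real.exp (-r * p.1))
      (((volume : Measure ℝ).restrict (Ici 0)).prod P)) :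
    Integrable φ ((expLaw r).prod P) := by
  rw [expLaw, prod_withDensity_left (measurable_expLaw_density r),
    integrable_withDensity_iff_integrable_smul'
      (f := fun z : ℝ × Ω => ENNReal.ofReal (r * Real.exp (-r * z.1)))
      ((measurable_expLaw_density r).comp measurable_fst)
      (.of_forall fun _ => ENNReal.ofReal_lt_top)]
  refine (h.const_mul r).congr (.of_forall fun p => ?_)
  simp only [smul_eq_mul]
  rw [ENNReal.toReal_ofReal (by positivity)]
  ring

lemma IsLevy.gittinsInf_eq (h : IsLevy P X F) (hr : 0 < r) (hg : Continuous g) {y : ℝ}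
    (hi : Integrable (fun b => g (y + b)) (infLaw P X r)) :
    gittinsInf P X g r y = ∫ b, g (y + b) / r ∂infLaw P X r := by
  have := isProbabilityMeasure_expLaw hr
  have hφ : Continuous fun b => g (y + b) := by fun_prop
  have hae : (fun z : ℝ × Ω => g (y + (sInf ((fun u => X u z.2) '' Icc 0 z.1) - X 0 z.2)))
      =ᵐ[(expLaw r).prod P] fun z => g (y + runInf X z.1 z.2) :=
    (h.runInf_ae_eq hr).fun_comp fun b => g (y + b)
  rw [integral_div, infLaw, expTimeLaw, integral_map
    (h.aemeasurable_functional isGridLimit_min 0 _ (IsLevy.ae_prod_nonneg hr))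
    hφ.aestronglyMeasurable, integral_congr_ae hae,
    integral_prod _ ((h.integrable_infLaw_iff hr hφ).1 hi), integral_expLaw hr,
    gittinsInf, ← integral_div]
  refine integral_congr_ae (.of_forall fun t => ?_)
  simp only [smul_eq_mul]
  field_simp

lemma isStopProblem_gittins (h : IsLevy P X F) (hr : 0 < r) (hg : Continuous g) (hmono : Monotone g)
    (x : ℝ)
    (hG : Integrable (fun p : ℝ × Ω => g (x + X p.1 p.2) * Real.exp (-r * p.1))
      (((volume : Measure ℝ).restrict (Ici 0)).prod P))
    (hκ : ∀ y : ℝ, Integrable (fun p : ℝ × Ω => g (y + runInf X p.1 p.2) * Real.exp (-r * p.1))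
      (((volume : Measure ℝ).restrict (Ici 0)).prod P)) :
    IsStopProblem P X F r (fun z => g (x + z) / r) (fun y => gittinsInf P X g r (x + y)) := by
  have hi : ∀ y, Integrable (fun b => g (y + b)) (infLaw P X r) := fun y =>
    (h.integrable_infLaw_iff hr (by fun_prop)).2 (integrable_expLaw_prod_of_discounted hr (hκ y))
  have hK : ∀ y, gittinsInf P X g r y = ∫ b, g (y + b) / r ∂infLaw P X r := fun y =>
    h.gittinsInf_eq hr hg (hi y)
  refine ⟨h, hr, ?_, (integrable_expLaw_prod_of_discounted hr hG).div_const r, fun y => ?_, ?_, ?_⟩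
  · exact (hg.comp (continuous_const_add x)).measurable.div_const r
  · simp only [hK, add_assoc]
  · simp only [hK]
    refine (?_ : Continuous fun y => ∫ b, g (y + b) / r ∂infLaw P X r).comp
      (continuous_const_add x)
    simp only [integral_div]
    refine Continuous.div_const (continuous_iff_continuousAt.2 fun y₀ => ?_) r
    refine continuousAt_of_dominated
      (bound := fun b => |g (y₀ - 1 + b)| + |g (y₀ + 1 + b)|) (.of_forall fun y => ?_) ?_
      ((hi _).abs.add (hi _).abs) (.of_forall fun b => ?_)
    · exact (hg.comp (continuous_const_add y)).aestronglyMeasurable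
    · filter_upwards [Ioo_mem_nhds (sub_one_lt y₀) (lt_add_one y₀)] with y hy
      refine .of_forall fun b => ?_
      have h1 : g (y₀ - 1 + b) ≤ g (y + b) := hmono (by linarith [hy.1])
      have h2 : g (y + b) ≤ g (y₀ + 1 + b) := hmono (by linarith [hy.2])
      rw [Real.norm_eq_abs, abs_le]
      constructor
      · linarith [neg_abs_le (g (y₀ - 1 + b)), abs_nonneg (g (y₀ + 1 + b))]
      · linarith [le_abs_self (g (y₀ + 1 + b)), abs_nonneg (g (y₀ - 1 + b))]
    · exact (hg.comp (continuous_add_const b)).continuousAt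
  · intro y y' hy
    simp only [hK]
    refine integral_mono ((hi _).div_const r) ((hi _).div_const r) fun b => ?_
    have := hmono (show x + y + b ≤ x + y' + b by linarith)
    simp only
    gcongr

lemma expLaw_real_ofReal_lt (hr : 0 < r) (e : ℝ≥0∞) :
    (expLaw r).real {t | ENNReal.ofReal t < e}
      = 1 - if e = ⊤ then 0 else Real.exp (-r * e.toReal) := by
  have := isProbabilityMeasure_expLaw hr
  split_ifs with he
  · simp [he]
  · have h1 : {t | ENNReal.ofReal t < e} =ᵐ[expLaw r] ((Ici e.toReal)ᶜ : Set ℝ) := by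
      filter_upwards [ae_expLaw_nonneg r] with t ht
      refine propext ?_
      change ENNReal.ofReal t < e ↔ ¬ e.toReal ≤ t
      rw [not_le, ENNReal.ofReal_lt_iff_lt_toReal ht he]
    rw [measureReal_congr h1, probReal_compl_eq_one_sub measurableSet_Ici, Measure.real,
      expLaw_Ici hr ENNReal.toReal_nonneg, ENNReal.toReal_ofReal (by positivity)]

lemma gPayoff_eq_runPayoff (hr : 0 < r)
    (hi : Integrable (fun z : ℝ × Ω => g (x + X z.1 z.2) / r) ((expLaw r).prod P))
    (c : ℝ) {τ : Ω → ℝ≥0∞} (hτ : Measurable τ) :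
    gPayoff P X g x r c τ = runPayoff P X r (fun z => g (x + z) / r) c τ := by
  have := isProbabilityMeasure_expLaw hr
  have hA := measurableSet_ofReal_lt hτ
  set f : ℝ × Ω → ℝ := {z : ℝ × Ω | ENNReal.ofReal z.1 < τ z.2}.indicator
    fun z => g (x + X z.1 z.2) / r - c with hf
  have hfi : Integrable f ((expLaw r).prod P) := (hi.sub (integrable_const c)).indicator hA
  have h1 : runPayoff P X r (fun z => g (x + z) / r) c τ
      = ∫ ω, (c + ∫ t, f (t, ω) ∂expLaw r) ∂P := by
    rw [runPayoff, ← integral_indicator hA, integral_prod_symm _ hfi,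
      integral_add (integrable_const c) hfi.integral_prod_right]
    simp
  rw [h1, gPayoff]
  refine integral_congr_ae ?_
  filter_upwards [hi.prod_left_ae] with ω hω
  have hS : MeasurableSet {t | ENNReal.ofReal t < τ ω} :=
    measurableSet_lt (by fun_prop) measurable_const
  have h2 : ∫ t, f (t, ω) ∂expLaw r
      = ∫ t in {t | ENNReal.ofReal t < τ ω}, g (x + X t ω) / r ∂expLaw r
        - c * (expLaw r).real {t | ENNReal.ofReal t < τ ω} := by
    have h3 : (fun t => f (t, ω)) = {t | ENNReal.ofReal t < τ ω}.indicator
        fun t => g (x + X t ω) / r - c := rfl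
    rw [h3, integral_indicator hS, integral_sub hω.integrableOn (integrable_const c),
      setIntegral_const, smul_eq_mul, mul_comm c]
  have h4 : ∫ t in {t | ENNReal.ofReal t < τ ω}, g (x + X t ω) / r ∂expLaw r
      = ∫ t, {s : ℝ | 0 ≤ s ∧ ENNReal.ofReal s < τ ω}.indicator
        (fun s => g (x + X s ω) * Real.exp (-r * s)) t := by
    rw [← integral_indicator hS, integral_expLaw hr, ← integral_indicator measurableSet_Ici]
    refine integral_congr_ae (.of_forall fun t => ?_)
    by_cases ht : 0 ≤ t <;> by_cases hτt : ENNReal.ofReal t < τ ω <;>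
      simp [indicator, ht, hτt]
    field_simp
  rw [h2, h4, expLaw_real_ofReal_lt hr]
  ring

end Bridge

/-- solution of the parameterised stopping problem via the Gittins index.
The first passage time `τ*(c) = inf{t ≥ 0 : κ(x + X_t) ≥ c}` attains the infimum defining
`v(x,c)`; moreover `v(x,c) = c` when `κ(x) ≥ c` and `v(x,c) < c` when `κ(x) < c`. -/
theorem gittins_solves_stopping_problem
    {Ω : Type*} [m : MeasurableSpace Ω] (P : Measure Ω) [IsProbabilityMeasure P]
    (X : ℝ → Ω → ℝ)
    (hXmeas : Measurable (Function.uncurry X))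
    (hXsm : ∀ t, StronglyMeasurable (X t))
    (hX0 : ∀ᵐ ω ∂P, X 0 ω = 0)
    (hXrc : ∀ ω t, ContinuousWithinAt (fun s => X s ω) (Set.Ici t) t)
    (hXll : ∀ ω t, ∃ L, Tendsto (fun s => X s ω) (nhdsWithin t (Set.Iio t)) (nhds L))
    (hstat : ∀ s t : ℝ, 0 ≤ s → s ≤ t →
      Measure.map (fun ω => X t ω - X s ω) P = Measure.map (X (t - s)) P)
    (hindep : ∀ s t : ℝ, 0 ≤ s → s ≤ t →
      ProbabilityTheory.Indep (MeasurableSpace.comap (fun ω => X t ω - X s ω) inferInstance)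
        ((Filtration.natural X hXsm) s) P)
    (r : ℝ) (hr : 0 < r)
    (g : ℝ → ℝ) (hgcont : Continuous g) (hgmono : Monotone g)
    (hGfin : ∀ x : ℝ, Integrable (fun p : ℝ × Ω => g (x + X p.1 p.2) * Real.exp (-r * p.1))
      (((volume : Measure ℝ).restrict (Set.Ici 0)).prod P))
    (hκfin : ∀ y : ℝ, Integrable (fun p : ℝ × Ω => g (y + runInf X p.1 p.2) * Real.exp (-r * p.1))
      (((volume : Measure ℝ).restrict (Set.Ici 0)).prod P))
    (x c : ℝ)
    -- the first passage time of the Gittins index over the level `c`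
    (τstar : Ω → ℝ≥0∞)
    (hτstar : ∀ ω, τstar ω = sInf {e : ℝ≥0∞ | ∃ u : ℝ, 0 ≤ u ∧ e = ENNReal.ofReal u ∧
        c ≤ gittinsInf P X g r (x + X u ω)}) :
    stopValue P X hXsm g x r c = gPayoff P X g x r c τstar ∧
      (c ≤ gittinsInf P X g r x → stopValue P X hXsm g x r c = c) ∧
      (gittinsInf P X g r x < c → stopValue P X hXsm g x r c < c) := by
  have hL : IsLevy P X (Filtration.natural X hXsm) :=
    ⟨hXmeas, fun t => ((Filtration.stronglyAdapted_natural hXsm) t).measurable, hX0,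
      fun ω => ⟨hXrc ω, hXll ω⟩, hstat, hindep⟩
  set K : ℝ → ℝ := fun y => gittinsInf P X g r (x + y) with hK
  have h : IsStopProblem P X (Filtration.natural X hXsm) r (fun z => g (x + z) / r) K :=
    isStopProblem_gittins hL hr hgcont hgmono x (hGfin x) hκfin
  have hpay : ∀ {τ : Ω → ℝ≥0∞}, Measurable τ →
      gPayoff P X g x r c τ = runPayoff P X r (fun z => g (x + z) / r) c τ :=
    fun hτ => gPayoff_eq_runPayoff hr h.int c hτ
  have hV : stopValue P X hXsm g x r c = gittinsValue P X r K c := by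
    have hlow : ∀ y ∈ {y : ℝ | ∃ τ : Ω → ℝ≥0∞,
        IsStopTimeE (Filtration.natural X hXsm) τ ∧ y = gPayoff P X g x r c τ},
        gittinsValue P X r K c ≤ y := by
      rintro _ ⟨τ, hτ, rfl⟩
      rw [hpay hτ.isOptional.measurable]
      exact h.value_le_runPayoff hτ.isOptional c
    have hst := fun n => h.isStopTimeE_hitIdx c (mesh_pos n)
    refine le_antisymm ?_ (le_csInf ⟨_, _, hst 0, rfl⟩ hlow)
    refine ge_of_tendsto' (h.tendsto_runPayoff_hitIdx c) fun n => ?_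
    rw [← hpay (hst n).isOptional.measurable]
    exact csInf_le ⟨_, hlow⟩ ⟨_, hst n, rfl⟩
  have hτ : τstar = passageTime X K c := funext hτstar
  have hK0 : K 0 = gittinsInf P X g r x := by simp [hK]
  refine ⟨?_, fun hc => ?_, fun hc => ?_⟩
  · have h1 : gPayoff P X g x r c τstar = gPayoff P X g x r c (limHitTime X K c) := by
      refine integral_congr_ae ?_
      filter_upwards [h.passageTime_ae_eq c] with ω hω
      rw [hτ, hω]
    rw [h1, hpay (h.isOptional_limHitTime c).measurable, h.runPayoff_limHitTime, hV]
  · rw [hV, h.gittinsValue_eq_of_le (hK0 ▸ hc)]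
  · rw [hV]
    exact h.gittinsValue_lt (hK0 ▸ hc)

end
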